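/- Every 26-dimensional unimodular lattice with no vectors of norm 1 has a characteristic vector of norm 10: if L is a positive definite unimodular integral lattice of rank 26 such that B(x, x) ≠ 1 for all x ∈ L, then there exists c ∈ L with B(c, c) = 10 and B(c, x) ≡ B(x, x) (mod 2) for all x ∈ L. -/

import Mathlib

open MeasureTheory in
/-- The fundamental cubes tile space, so an integral is a sum of integrals over one cube. -/
theorem integral_eq_tsum_integral_unitCube {ι : Type*} [Fintype ι] {g : (ι → ℝ) → ℂ}
    (hg : Integrable g) :
    ∫ v, g v = ∑' m : ι → ℤ, ∫ v in {x : ι → ℝ | ∀ i, x i ∈ Set.Ioc (0 : ℝ) (0 + 1)},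
      g (v + fun i => (m i : ℝ)) := by
  set C : Set (ι → ℝ) := {x | ∀ i, x i ∈ Set.Ioc (0 : ℝ) (0 + 1)} with hC
  have hCm : MeasurableSet C := MeasurableSet.univ_pi' fun i => measurableSet_Ioc
  let S : (ι → ℤ) → Set (ι → ℝ) := fun m => (fun v => v + fun i => -(m i : ℝ)) ⁻¹' C
  have hSm : ∀ m, MeasurableSet (S m) := fun m => (measurable_add_const _) hCm
  have hU : ⋃ m, S m = Set.univ := by
    refine Set.eq_univ_of_forall fun v => Set.mem_iUnion.2 ⟨fun i => ⌈v i⌉ - 1, fun i => ?_⟩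
    have h1 := Int.ceil_lt_add_one (v i)
    have h2 := Int.le_ceil (v i)
    simp only [Pi.add_apply, Set.mem_Ioc]
    push_cast
    constructor <;> linarith
  have hD : Pairwise fun a b => Disjoint (S a) (S b) := by
    intro a b hab
    refine Set.disjoint_left.2 fun v ha hb => hab (funext fun i => ?_)
    have h1 := ha i
    have h2 := hb i
    simp only [Pi.add_apply, Set.mem_Ioc] at h1 h2
    have h3 : (a i : ℝ) < b i + 1 := by linarith
    have h4 : (b i : ℝ) < a i + 1 := by linarith
    norm_cast at h3 h4
    lia
  rw [← setIntegral_univ, ← hU, integral_iUnion hSm hD hg.integrableOn]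
  refine tsum_congr fun m => ?_
  have hmp := (measurePreserving_add_right (volume : Measure (ι → ℝ)) fun i => (m i : ℝ))
  rw [← hmp.setIntegral_preimage_emb (measurableEmbedding_addRight _)]
  congr 2
  ext v
  simp [S, hC]

open MeasureTheory UnitAddTorus in
/-- Poisson summation for the lattice `ι → ℤ` in `ι → ℝ`. -/
theorem tsum_int_translate_eq_tsum_fourier {ι : Type*} [Fintype ι] {f : (ι → ℝ) → ℂ}
    (hf : Continuous f) (hint : Integrable f)
    (hbd : ∀ R : ℝ, ∃ u : (ι → ℤ) → ℝ, Summable u ∧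
      ∀ w, ‖w‖ ≤ R → ∀ m : ι → ℤ, ‖f (w + fun i => (m i : ℝ))‖ ≤ u m)
    (hF : Summable fun m : ι → ℤ =>
      ∫ v, Complex.exp (-(2 * Real.pi * Complex.I * ∑ i, (m i : ℂ) * v i)) * f v)
    (w : ι → ℝ) :
    ∑' m : ι → ℤ, f (w + fun i => (m i : ℝ)) = ∑' m : ι → ℤ,
      (∫ v, Complex.exp (-(2 * Real.pi * Complex.I * ∑ i, (m i : ℂ) * v i)) * f v) *
        Complex.exp (2 * Real.pi * Complex.I * ∑ i, (m i : ℂ) * w i) := by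
  set G : (ι → ℝ) → ℂ := fun w => ∑' m : ι → ℤ, f (w + fun i => (m i : ℝ)) with hG
  have hGc : Continuous G := by
    rw [continuous_iff_continuousAt]
    intro w₀
    obtain ⟨u, hu, hub⟩ := hbd (‖w₀‖ + 1)
    have : ContinuousOn G (Metric.ball 0 (‖w₀‖ + 1)) :=
      continuousOn_tsum (fun m => (hf.comp (continuous_add_const _)).continuousOn) hu
        fun m w hw => hub w (by simpa using (mem_ball_zero_iff.1 hw).le) m
    exact this.continuousAt (Metric.isOpen_ball.mem_nhds (by simp))
  have hGper : ∀ (w : ι → ℝ) (n : ι → ℤ), G (w + fun i => (n i : ℝ)) = G w := by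
    intro w n
    simp only [hG]
    rw [← (Equiv.addLeft n).tsum_eq (fun m : ι → ℤ => f (w + fun i => (m i : ℝ)))]
    refine tsum_congr fun m => congrArg f ?_
    ext i
    simp [add_assoc]
  let p : (ι → ℝ) → UnitAddTorus ι := fun x i => (x i : UnitAddCircle)
  have hp : IsOpenQuotientMap p := IsOpenQuotientMap.piMap fun i =>
    (QuotientAddGroup.isOpenQuotientMap_mk :
      IsOpenQuotientMap (QuotientAddGroup.mk : ℝ → UnitAddCircle))
  let g : UnitAddTorus ι → ℂ := fun x => G (Function.surjInv hp.surjective x)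
  have hgp : ∀ w, g (p w) = G w := by
    intro w
    have h := Function.surjInv_eq hp.surjective (p w)
    set w' := Function.surjInv hp.surjective (p w) with hw'
    have : ∀ i, ∃ n : ℤ, w' i = w i + n := by
      intro i
      have h := congrFun h i
      obtain ⟨n, hn⟩ := AddSubgroup.mem_zmultiples_iff.1 (QuotientAddGroup.eq.1 h.symm)
      refine ⟨n, ?_⟩
      have hn : (n : ℝ) = -w i + w' i := by simpa using hn
      linarith
    choose n hn using this
    have : w' = w + fun i => (n i : ℝ) := funext hn
    change G w' = G w
    rw [this, hGper]
  have hgc : Continuous g := by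
    rw [hp.isQuotientMap.continuous_iff]
    exact hGc.congr fun w => (hgp w).symm
  have hmF : ∀ (m : ι → ℤ) (w : ι → ℝ), mFourier m (p w) =
      Complex.exp (2 * Real.pi * Complex.I * ∑ i, (m i : ℂ) * w i) := by
    intro m w
    simp only [mFourier, ContinuousMap.coe_mk, p, fourier_coe_apply, ← Complex.exp_sum,
      Finset.mul_sum]
    congr 1
    refine Finset.sum_congr rfl fun i _ => ?_
    push_cast
    ring
  have hcoef : ∀ n : ι → ℤ, mFourierCoeff g n =
      ∫ v, Complex.exp (-(2 * Real.pi * Complex.I * ∑ i, (n i : ℂ) * v i)) * f v := by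
    intro n
    set e : (ι → ℝ) → ℂ := fun v => Complex.exp (-(2 * Real.pi * Complex.I * ∑ i, (n i : ℂ) * v i))
      with he
    have hec : Continuous e := by fun_prop
    have hen : ∀ v, ‖e v‖ = 1 := by
      intro v
      have : -(2 * Real.pi * Complex.I * ∑ i, (n i : ℂ) * v i) =
          ((-(2 * Real.pi * ∑ i, (n i : ℝ) * v i) : ℝ) : ℂ) * Complex.I := by push_cast; ring
      rw [he]
      simp only
      rw [this, Complex.norm_exp_ofReal_mul_I]
    have heper : ∀ (v : ι → ℝ) (m : ι → ℤ), e (v + fun i => (m i : ℝ)) = e v := by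
      intro v m
      simp only [he]
      rw [Complex.exp_eq_exp_iff_exists_int]
      refine ⟨-∑ i, n i * m i, ?_⟩
      simp only [Pi.add_apply, Complex.ofReal_add, mul_add, Finset.sum_add_distrib,
        Complex.ofReal_intCast]
      push_cast
      ring
    have hIi : Integrable fun v => e v * f v :=
      hint.bdd_mul hec.aestronglyMeasurable (c := 1) (.of_forall fun v => (hen v).le)
    rw [mFourierCoeff_eq_integral g n 0, integral_eq_tsum_integral_unitCube hIi]
    obtain ⟨u, hu, hub⟩ := hbd 1
    set C : Set (ι → ℝ) := {x | ∀ i, x i ∈ Set.Ioc (0 : ℝ) (0 + 1)} with hC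
    have hCm : MeasurableSet C := MeasurableSet.univ_pi' fun i => measurableSet_Ioc
    have hCn : ∀ v ∈ C, ‖v‖ ≤ 1 := by
      intro v hv
      refine (pi_norm_le_iff_of_nonneg zero_le_one).2 fun i => ?_
      have := hv i
      simp only [zero_add, Set.mem_Ioc] at this
      rw [Real.norm_eq_abs, abs_of_pos this.1]
      exact this.2
    have hCf : volume C < ⊤ :=
      ((Metric.isBounded_iff_subset_closedBall 0).2
        ⟨1, fun v hv => by simpa using hCn v hv⟩).measure_lt_top
    have : IsFiniteMeasure (volume.restrict C) := ⟨by simpa using hCf⟩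
    have hsum : HasSum
        (fun m : ι → ℤ => ∫ v in C, e (v + fun i => (m i : ℝ)) * f (v + fun i => (m i : ℝ)))
        (∫ v in C, e v * G v) := by
      refine hasSum_integral_of_dominated_convergence (fun m _ => u m) (fun m => ?_) (fun m => ?_)
        ?_ ?_ ?_
      · exact Continuous.aestronglyMeasurable (by fun_prop)
      · refine (ae_restrict_iff' hCm).2 (.of_forall fun v hv => ?_)
        rw [norm_mul, hen, one_mul]
        exact hub v (hCn v hv) m
      · exact .of_forall fun _ => hu
      · exact integrable_const _
      · refine (ae_restrict_iff' hCm).2 (.of_forall fun v hv => ?_)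
        simp only [heper]
        refine HasSum.mul_left _ (Summable.hasSum ?_)
        exact .of_norm_bounded hu fun m => hub v (hCn v hv) m
    rw [hsum.tsum_eq]
    refine setIntegral_congr_fun hCm fun v _ => ?_
    simp only [smul_eq_mul]
    rw [show (fun i => ((v i : ℝ) : UnitAddCircle)) = p v from rfl, hgp, hmF]
    congr 2
    simp [mul_comm]
  have hS : Summable (mFourierCoeff (ContinuousMap.mk g hgc)) := by
    simpa only [ContinuousMap.coe_mk, funext hcoef] using hF
  have key := (hasSum_mFourier_series_apply_of_summable hS (p w)).tsum_eq
  simp only [ContinuousMap.coe_mk, hgp, hcoef, hmF, smul_eq_mul] at key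
  exact key.symm

/-- The real quadratic form of an integral Gram matrix. -/
noncomputable def Matrix.realForm {ι : Type*} [Fintype ι] (A : Matrix ι ι ℤ) (v : ι → ℝ) : ℝ :=
  dotProduct v ((A.map (Int.cast : ℤ → ℝ)).mulVec v)

/-- Gaussian sums over `ι → ℤ` converge. -/
theorem summable_exp_neg_sum_sq {ι : Type*} [Fintype ι] {a : ℝ} (ha : 0 < a) :
    Summable fun m : ι → ℤ => Real.exp (-(a * ∑ i, (m i : ℝ) ^ 2)) := by
  classical
  have h1 : Summable fun n : ℤ => Real.exp (-(a * (n : ℝ) ^ 2)) := by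
    have h := summable_pow_mul_jacobiTheta₂_term_bound 0 (div_pos ha Real.pi_pos) 0
    refine h.congr fun n => ?_
    rw [pow_zero, one_mul]
    congr 1
    field_simp
    ring
  refine summable_of_sum_le (c := ∏ _i : ι, ∑' n : ℤ, Real.exp (-(a * (n : ℝ) ^ 2)))
    (fun m => (Real.exp_pos _).le) fun s => ?_
  calc ∑ m ∈ s, Real.exp (-(a * ∑ i, (m i : ℝ) ^ 2))
      ≤ ∑ m ∈ Fintype.piFinset fun i => s.image fun m : ι → ℤ => m i,
          Real.exp (-(a * ∑ i, (m i : ℝ) ^ 2)) := by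
        refine Finset.sum_le_sum_of_subset_of_nonneg (fun m hm => ?_)
          fun m _ _ => (Real.exp_pos _).le
        exact Fintype.mem_piFinset.2 fun i => Finset.mem_image_of_mem (fun m : ι → ℤ => m i) hm
    _ = ∏ i, ∑ n ∈ s.image fun m : ι → ℤ => m i, Real.exp (-(a * (n : ℝ) ^ 2)) := by
        rw [Finset.prod_univ_sum]
        refine Finset.sum_congr rfl fun m _ => ?_
        rw [← Real.exp_sum, Finset.mul_sum, Finset.sum_neg_distrib]
    _ ≤ _ := Finset.prod_le_prod (fun i _ => Finset.sum_nonneg fun n _ => (Real.exp_pos _).le)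
        fun i _ => h1.sum_le_tsum _ fun n _ => (Real.exp_pos _).le

section GramMatrix

open Matrix

variable {ι : Type*} [Fintype ι] {A : Matrix ι ι ℤ}

theorem realForm_eq_sum_sq {M : Matrix ι ι ℝ} (hM : A.map (Int.cast : ℤ → ℝ) = Mᵀ * M)
    (v : ι → ℝ) : A.realForm v = ∑ i, (M *ᵥ v) i ^ 2 := by
  rw [realForm, hM, ← mulVec_mulVec, dotProduct_mulVec, vecMul_transpose]
  simp [dotProduct, sq]

variable [DecidableEq ι]

open scoped MatrixOrder Matrix.Norms.L2Operator in
theorem exists_transpose_mul_self (hA : (A.map (Int.cast : ℤ → ℝ)).PosDef) (hdet : A.det = 1) :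
    ∃ M : Matrix ι ι ℝ, A.map (Int.cast : ℤ → ℝ) = Mᵀ * M ∧ M.det ^ 2 = 1 := by
  obtain ⟨M, hM⟩ := CStarAlgebra.nonneg_iff_eq_star_mul_self.mp hA.posSemidef.nonneg
  rw [star_eq_conjTranspose, conjTranspose_eq_transpose_of_trivial] at hM
  refine ⟨M, hM, ?_⟩
  have h := congrArg det hM
  rw [det_mul, det_transpose] at h
  have h2 : (A.map (Int.cast : ℤ → ℝ)).det = ((A.det : ℤ) : ℝ) :=
    ((Int.castRingHom ℝ).map_det A).symm
  rw [h2, hdet] at h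
  rw [sq, ← h]
  simp

theorem exists_mul_sum_sq_le_realForm (hA : (A.map (Int.cast : ℤ → ℝ)).PosDef)
    (hdet : A.det = 1) : ∃ δ : ℝ, 0 < δ ∧ ∀ v, δ * ∑ i, v i ^ 2 ≤ A.realForm v := by
  obtain ⟨M, hM, hd⟩ := exists_transpose_mul_self hA hdet
  have hu : IsUnit M.det := IsUnit.of_mul_eq_one M.det (by rw [← sq, hd])
  set K : ℝ := ∑ i, ∑ j, M⁻¹ i j ^ 2
  have hK : 0 ≤ K := by positivity
  refine ⟨1 / (K + 1), by positivity, fun v => ?_⟩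
  rw [realForm_eq_sum_sq hM, div_mul_eq_mul_div, one_mul, div_le_iff₀ (by positivity)]
  have hv : v = M⁻¹ *ᵥ (M *ᵥ v) := by
    rw [mulVec_mulVec, nonsing_inv_mul _ hu, one_mulVec]
  set u := M *ᵥ v
  calc ∑ i, v i ^ 2 ≤ ∑ i, (∑ j, M⁻¹ i j ^ 2) * ∑ j, u j ^ 2 := by
        refine Finset.sum_le_sum fun i _ => ?_
        rw [hv]
        exact Finset.sum_mul_sq_le_sq_mul_sq _ _ _
    _ = K * ∑ j, u j ^ 2 := by rw [Finset.sum_mul]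
    _ ≤ _ := by
        have : 0 ≤ ∑ j, u j ^ 2 := by positivity
        nlinarith

theorem exists_summable_exp_neg_realForm_le (hA : (A.map (Int.cast : ℤ → ℝ)).PosDef)
    (hdet : A.det = 1) {a : ℝ} (ha : 0 < a) (R : ℝ) :
    ∃ u : (ι → ℤ) → ℝ, Summable u ∧ ∀ w, ‖w‖ ≤ R → ∀ m : ι → ℤ,
      Real.exp (-(a * A.realForm (w + fun i => (m i : ℝ)))) ≤ u m := by
  obtain ⟨δ, hδ, hq⟩ := exists_mul_sum_sq_le_realForm hA hdet
  refine ⟨_, (summable_exp_neg_sum_sq (ι := ι) (a := a * δ / 2) (by positivity)).mul_left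
    (Real.exp (a * δ * ∑ _i : ι, R ^ 2)), fun w hw m => ?_⟩
  rw [← Real.exp_add, Real.exp_le_exp]
  have h1 : ∑ i, ((m i : ℝ) ^ 2 / 2 - R ^ 2) ≤ ∑ i, (w + fun i => (m i : ℝ)) i ^ 2 := by
    refine Finset.sum_le_sum fun i _ => ?_
    have h2 : |w i| ≤ R := (norm_le_pi_norm w i).trans hw
    have h3 : w i ^ 2 ≤ R ^ 2 := sq_le_sq' (abs_le.1 h2).1 (abs_le.1 h2).2
    simp only [Pi.add_apply]
    nlinarith [sq_nonneg (2 * w i + m i)]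
  have h4 := mul_le_mul_of_nonneg_left (h1) (mul_pos ha hδ).le
  have h5 := mul_le_mul_of_nonneg_left (hq (w + fun i => (m i : ℝ))) ha.le
  rw [Finset.sum_sub_distrib, ← Finset.sum_div] at h4
  linarith

theorem summable_exp_neg_realForm (hA : (A.map (Int.cast : ℤ → ℝ)).PosDef)
    (hdet : A.det = 1) {a : ℝ} (ha : 0 < a) (w : ι → ℝ) :
    Summable fun m : ι → ℤ => Real.exp (-(a * A.realForm (w + fun i => (m i : ℝ)))) := by
  obtain ⟨u, hu, h⟩ := exists_summable_exp_neg_realForm_le hA hdet ha ‖w‖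
  exact .of_nonneg_of_le (fun m => (Real.exp_pos _).le) (h w le_rfl) hu

theorem norm_exp_pi_I_mul_realForm (τ : ℂ) (x : ℝ) :
    ‖Complex.exp (Real.pi * Complex.I * τ * x)‖ = Real.exp (-(Real.pi * τ.im * x)) := by
  rw [Complex.norm_exp]
  congr 1
  simp [mul_assoc]

open MeasureTheory in
/-- The Fourier transform of a complex Gaussian on a unimodular lattice, at a dual vector. -/
theorem integral_exp_realForm (hA : (A.map (Int.cast : ℤ → ℝ)).PosDef) (hdet : A.det = 1)
    {k : ℕ} (hk : Fintype.card ι = 2 * k) {τ : ℂ} (hτ : 0 < τ.im) (m : ι → ℤ) :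
    Integrable (fun v => Complex.exp (Real.pi * Complex.I * τ * A.realForm v)) ∧
    ∫ v, Complex.exp (-(2 * Real.pi * Complex.I * ∑ i, ((A *ᵥ m) i : ℂ) * v i)) *
      Complex.exp (Real.pi * Complex.I * τ * A.realForm v) =
    (Complex.I / τ) ^ k * Complex.exp (Real.pi * Complex.I * (-1 / τ) *
      A.realForm fun i => (m i : ℝ)) := by
  obtain ⟨M, hM, hd⟩ := exists_transpose_mul_self hA hdet
  have hd0 : M.det ≠ 0 := fun h => by simp [h] at hd
  have habs : |M.det⁻¹| = 1 := by
    rw [abs_inv, inv_eq_one, abs_eq zero_le_one]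
    exact sq_eq_one_iff.1 hd
  have hmp : MeasurePreserving (toLin' M) (volume : Measure (ι → ℝ)) volume := by
    refine ⟨(LinearMap.continuous_on_pi _).measurable, ?_⟩
    rw [Real.map_matrix_volume_pi_eq_smul_volume_pi hd0, habs]
    simp
  have hemb : MeasurableEmbedding (toLin' M) := by
    have hinj : Function.Injective (toLin' M) :=
      mulVec_injective_of_isUnit ((isUnit_iff_isUnit_det M).2 hd0.isUnit)
    exact (LinearMap.continuous_on_pi _).measurableEmbedding hinj
  have hτ0 : τ ≠ 0 := fun h => by simp [h] at hτ
  have hπ : (Real.pi : ℂ) ≠ 0 := by exact_mod_cast Real.pi_ne_zero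
  set b : ℂ := -(Real.pi * Complex.I * τ) with hb
  have hbre : 0 < b.re := by
    have : b.re = Real.pi * τ.im := by simp [hb]
    rw [this]
    positivity
  set s : ι → ℝ := M *ᵥ fun i => (m i : ℝ) with hs
  set c : ι → ℂ := fun i => -(2 * Real.pi * Complex.I * s i) with hc
  have hAm : ∀ v : ι → ℝ, ∑ i, ((A *ᵥ m) i : ℝ) * v i = ∑ i, s i * (M *ᵥ v) i := by
    intro v
    have h1 : (fun i => ((A *ᵥ m) i : ℝ)) = A.map (Int.cast : ℤ → ℝ) *ᵥ fun i => (m i : ℝ) :=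
      funext fun i => RingHom.map_mulVec (Int.castRingHom ℝ) A m i
    change (fun i => ((A *ᵥ m) i : ℝ)) ⬝ᵥ v = s ⬝ᵥ M *ᵥ v
    rw [h1, hM, ← mulVec_mulVec, dotProduct_mulVec, mulVec_transpose, hs]
  have h1 : ∀ v : ι → ℝ,
      Complex.exp (-(2 * Real.pi * Complex.I * ∑ i, ((A *ᵥ m) i : ℂ) * v i)) *
        Complex.exp (Real.pi * Complex.I * τ * A.realForm v) =
      (fun u : ι → ℝ => Complex.exp (-b * ∑ i, (u i : ℂ) ^ 2 + ∑ i, c i * u i))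
        (toLin' M v) := by
    intro v
    rw [← Complex.exp_add, realForm_eq_sum_sq hM]
    simp only [toLin'_apply]
    congr 1
    have := congrArg (Complex.ofReal) (hAm v)
    push_cast at this
    rw [this]
    simp only [hc, hb, neg_mul, Finset.sum_neg_distrib, Finset.mul_sum]
    push_cast
    simp only [Finset.mul_sum, mul_assoc]
    ring
  constructor
  · have h2 : (fun v => Complex.exp (Real.pi * Complex.I * τ * A.realForm v)) =
        (fun u : ι → ℝ => Complex.exp (-b * ∑ i, (u i : ℂ) ^ 2 + ∑ i, (0 : ι → ℂ) i * u i)) ∘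
          (toLin' M) := by
      ext v
      simp [realForm_eq_sum_sq hM, hb, toLin'_apply]
    rw [h2, hmp.integrable_comp_emb hemb]
    exact GaussianFourier.integrable_cexp_neg_mul_sum_add hbre 0
  · simp_rw [h1]
    rw [hmp.integral_comp hemb
      (fun u : ι → ℝ => Complex.exp (-b * ∑ i, (u i : ℂ) ^ 2 + ∑ i, c i * u i)),
      GaussianFourier.integral_cexp_neg_mul_sum_add hbre, hk]
    congr 1
    · rw [show (((2 * k : ℕ) : ℂ) / 2) = (k : ℂ) by push_cast; ring, Complex.cpow_natCast]
      congr 1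
      rw [hb]
      field_simp
      rw [Complex.I_sq]
    · rw [realForm_eq_sum_sq hM]
      congr 1
      simp only [hc, hb, neg_sq, mul_pow, ← Finset.mul_sum, Complex.I_sq]
      push_cast
      field_simp
      rw [Complex.I_sq]
      ring

/-- Left multiplication by a unimodular integral matrix permutes the integral vectors. -/
noncomputable def mulVecEquivOfDetEqOne (hdet : A.det = 1) : (ι → ℤ) ≃ (ι → ℤ) where
  toFun m := A *ᵥ m
  invFun m := A⁻¹ *ᵥ m
  left_inv m := by simp [mulVec_mulVec, nonsing_inv_mul A (by simp [hdet])]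
  right_inv m := by simp [mulVec_mulVec, mul_nonsing_inv A (by simp [hdet])]

/-- The inversion formula for the theta series of a translated unimodular lattice. -/
theorem tsum_exp_realForm_eq (hA : (A.map (Int.cast : ℤ → ℝ)).PosDef) (hdet : A.det = 1)
    {k : ℕ} (hk : Fintype.card ι = 2 * k) {τ : ℂ} (hτ : 0 < τ.im) (w : ι → ℝ) :
    ∑' m : ι → ℤ, Complex.exp (Real.pi * Complex.I * τ *
      A.realForm (w + fun i => (m i : ℝ))) =
    (Complex.I / τ) ^ k * ∑' m : ι → ℤ,
      Complex.exp (Real.pi * Complex.I * (-1 / τ) * A.realForm fun i => (m i : ℝ)) *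
      Complex.exp (2 * Real.pi * Complex.I * ∑ i, ((A *ᵥ m) i : ℂ) * w i) := by
  have hc : Continuous A.realForm := by
    unfold realForm
    fun_prop
  have hτ' : 0 < (-1 / τ).im := by
    have : (-1 / τ).im = τ.im / Complex.normSq τ := by
      simp [neg_div]
    rw [this]
    exact div_pos hτ (Complex.normSq_pos.2 fun h => by simp [h] at hτ)
  set F : (ι → ℤ) → ℂ := fun n =>
    ∫ v, Complex.exp (-(2 * Real.pi * Complex.I * ∑ i, (n i : ℂ) * v i)) *
      Complex.exp (Real.pi * Complex.I * τ * A.realForm v) with hF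
  have hFA : ∀ m : ι → ℤ, F (mulVecEquivOfDetEqOne hdet m) = (Complex.I / τ) ^ k *
      Complex.exp (Real.pi * Complex.I * (-1 / τ) * A.realForm fun i => (m i : ℝ)) :=
    fun m => (integral_exp_realForm hA hdet hk hτ m).2
  have hFs : Summable F := by
    rw [← (mulVecEquivOfDetEqOne hdet).summable_iff]
    refine Summable.congr (Summable.mul_left ((Complex.I / τ) ^ k) (Summable.of_norm
      (f := fun m : ι → ℤ => Complex.exp (Real.pi * Complex.I * (-1 / τ) *
        A.realForm fun i => (m i : ℝ))) ?_)) fun m => (hFA m).symm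
    simp only [norm_exp_pi_I_mul_realForm]
    simpa using summable_exp_neg_realForm hA hdet (mul_pos Real.pi_pos hτ') 0
  have key := tsum_int_translate_eq_tsum_fourier
    (f := fun v => Complex.exp (Real.pi * Complex.I * τ * A.realForm v)) (by fun_prop)
    (integral_exp_realForm hA hdet hk hτ 0).1 (fun R => by
      simp only [norm_exp_pi_I_mul_realForm]
      exact exists_summable_exp_neg_realForm_le hA hdet (mul_pos Real.pi_pos hτ) R) hFs w
  rw [key, ← tsum_mul_left]
  refine ((mulVecEquivOfDetEqOne hdet).tsum_eq fun n : ι → ℤ => F n *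
    Complex.exp (2 * Real.pi * Complex.I * ∑ i, (n i : ℂ) * w i)).symm.trans
    (tsum_congr fun m => ?_)
  rw [hFA, mul_assoc]
  rfl

end GramMatrix

section LatticeTheta

open Matrix Complex

variable {ι : Type*} [Fintype ι] {A : Matrix ι ι ℤ}

theorem realForm_intCast (A : Matrix ι ι ℤ) (m : ι → ℤ) :
    A.realForm (fun i => (m i : ℝ)) = ((m ⬝ᵥ A *ᵥ m : ℤ) : ℝ) := by
  simp [realForm, dotProduct, mulVec]

/-- The norm of `c + 2m` for `c = Σ cᵢ eᵢ` is four times that of `c / 2 + m`. -/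
theorem realForm_half_add (A : Matrix ι ι ℤ) (c m : ι → ℤ) :
    A.realForm ((fun i => (c i : ℝ) / 2) + fun i => (m i : ℝ)) =
      (((c + 2 • m) ⬝ᵥ A *ᵥ (c + 2 • m) : ℤ) : ℝ) / 4 := by
  rw [← realForm_intCast]
  have : (fun i => (((c + 2 • m) i : ℤ) : ℝ)) =
      (2 : ℝ) • ((fun i => (c i : ℝ) / 2) + fun i => (m i : ℝ)) := by
    ext i
    simp
    ring
  rw [this]
  simp only [realForm, mulVec_smul, dotProduct_smul, smul_dotProduct, smul_eq_mul]
  ring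

/-- The theta series of the translate by `w` of the lattice with Gram matrix `A`. -/
noncomputable def latticeTheta (A : Matrix ι ι ℤ) (w : ι → ℝ) (τ : ℂ) : ℂ :=
  ∑' m : ι → ℤ, cexp (Real.pi * I * τ * A.realForm (w + fun i => (m i : ℝ)))

theorem im_neg_one_div_pos {τ : ℂ} (hτ : 0 < τ.im) : 0 < (-1 / τ).im := by
  have : (-1 / τ).im = τ.im / normSq τ := by
    simp [neg_div]
  rw [this]
  exact div_pos hτ (normSq_pos.2 fun h => by simp [h] at hτ)

/-- A characteristic vector of the lattice with Gram matrix `A`. -/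
def IsCharacteristic (A : Matrix ι ι ℤ) (c : ι → ℤ) : Prop :=
  ∀ m : ι → ℤ, (2 : ℤ) ∣ c ⬝ᵥ A *ᵥ m - m ⬝ᵥ A *ᵥ m

theorem realForm_nonneg (hA : (A.map (Int.cast : ℤ → ℝ)).PosDef) (v : ι → ℝ) :
    0 ≤ A.realForm v := by
  simpa [realForm] using hA.posSemidef.dotProduct_mulVec_nonneg v

theorem cexp_pi_I_mul_int_eq {a b : ℤ} (h : (2 : ℤ) ∣ a - b) :
    cexp (Real.pi * I * a) = cexp (Real.pi * I * b) := by
  obtain ⟨n, hn⟩ := h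
  rw [exp_eq_exp_iff_exists_int]
  refine ⟨n, ?_⟩
  have : (a : ℂ) = b + 2 * n := by exact_mod_cast eq_add_of_sub_eq' hn
  rw [this]
  ring

theorem latticeTheta_zero_add_one (τ : ℂ) : latticeTheta A 0 (τ + 1) =
    ∑' m : ι → ℤ, cexp (Real.pi * I * τ * A.realForm fun i => (m i : ℝ)) *
      cexp (Real.pi * I * (m ⬝ᵥ A *ᵥ m : ℤ)) := by
  refine tsum_congr fun m => ?_
  rw [zero_add, ← Complex.exp_add, realForm_intCast]
  congr 1
  push_cast
  ring

theorem latticeTheta_zero_add_two (τ : ℂ) :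
    latticeTheta A 0 (τ + 1 + 1) = latticeTheta A 0 τ := by
  rw [latticeTheta_zero_add_one]
  refine tsum_congr fun m => ?_
  rw [zero_add, ← Complex.exp_add, realForm_intCast, exp_eq_exp_iff_exists_int]
  refine ⟨m ⬝ᵥ A *ᵥ m, ?_⟩
  push_cast
  ring

variable [DecidableEq ι]

theorem summable_latticeTheta (hA : (A.map (Int.cast : ℤ → ℝ)).PosDef) (hdet : A.det = 1)
    (w : ι → ℝ) {τ : ℂ} (hτ : 0 < τ.im) :
    Summable fun m : ι → ℤ => cexp (Real.pi * I * τ * A.realForm (w + fun i => (m i : ℝ))) := by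
  refine .of_norm ?_
  simp only [norm_exp_pi_I_mul_realForm]
  exact summable_exp_neg_realForm hA hdet (mul_pos Real.pi_pos hτ) w

theorem differentiableOn_latticeTheta (hA : (A.map (Int.cast : ℤ → ℝ)).PosDef)
    (hdet : A.det = 1) (w : ι → ℝ) :
    DifferentiableOn ℂ (latticeTheta A w) {τ | 0 < τ.im} := by
  intro τ hτ
  obtain ⟨a, ha, haτ⟩ := exists_between (show 0 < τ.im from hτ)
  have hopen : IsOpen {τ : ℂ | a < τ.im} := isOpen_lt continuous_const continuous_im
  refine DifferentiableAt.differentiableWithinAt ?_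
  refine (differentiableOn_tsum_of_summable_norm
    (summable_exp_neg_realForm hA hdet (mul_pos Real.pi_pos ha) w) (fun m => by fun_prop)
    hopen fun m z hz => ?_).differentiableAt (hopen.mem_nhds haτ)
  rw [norm_exp_pi_I_mul_realForm, Real.exp_le_exp]
  have h1 := realForm_nonneg hA (w + fun i => (m i : ℝ))
  have h2 : a ≤ z.im := le_of_lt hz
  gcongr

theorem norm_latticeTheta_le (hA : (A.map (Int.cast : ℤ → ℝ)).PosDef) (hdet : A.det = 1)
    (w : ι → ℝ) {τ : ℂ} (hτ : 0 < τ.im) : ‖latticeTheta A w τ‖ ≤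
      ∑' m : ι → ℤ, Real.exp (-(Real.pi * τ.im * A.realForm (w + fun i => (m i : ℝ)))) := by
  refine (norm_tsum_le_tsum_norm ?_).trans_eq (tsum_congr fun m => ?_)
  · exact (summable_latticeTheta hA hdet w hτ).norm
  · exact norm_exp_pi_I_mul_realForm _ _

theorem norm_latticeTheta_le_of_one_le (hA : (A.map (Int.cast : ℤ → ℝ)).PosDef)
    (hdet : A.det = 1) (w : ι → ℝ) {τ : ℂ} (hτ : 1 ≤ τ.im) : ‖latticeTheta A w τ‖ ≤
      ∑' m : ι → ℤ, Real.exp (-(Real.pi * A.realForm (w + fun i => (m i : ℝ)))) := by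
  refine (norm_latticeTheta_le hA hdet w (by linarith)).trans ?_
  refine Summable.tsum_le_tsum (fun m => ?_)
    (summable_exp_neg_realForm hA hdet (mul_pos Real.pi_pos (by linarith)) w)
    (summable_exp_neg_realForm hA hdet Real.pi_pos w)
  rw [Real.exp_le_exp]
  have h1 := realForm_nonneg hA (w + fun i => (m i : ℝ))
  have h2 := mul_le_mul_of_nonneg_left hτ Real.pi_pos.le
  nlinarith

theorem latticeTheta_zero_neg_one_div (hA : (A.map (Int.cast : ℤ → ℝ)).PosDef)
    (hdet : A.det = 1) {k : ℕ} (hk : Fintype.card ι = 2 * k) {τ : ℂ} (hτ : 0 < τ.im) :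
    latticeTheta A 0 (-1 / τ) = (-I * τ) ^ k * latticeTheta A 0 τ := by
  have h0 : τ ≠ 0 := fun h => by simp [h] at hτ
  rw [latticeTheta, tsum_exp_realForm_eq hA hdet hk (im_neg_one_div_pos hτ)]
  congr 1
  · congr 1
    field_simp
  · refine tsum_congr fun m => ?_
    rw [zero_add]
    simp

theorem latticeTheta_half_neg_one_div (hA : (A.map (Int.cast : ℤ → ℝ)).PosDef)
    (hdet : A.det = 1) {k : ℕ} (hk : Fintype.card ι = 2 * k) {c : ι → ℤ}
    (hc : IsCharacteristic A c) {τ : ℂ} (hτ : 0 < τ.im) :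
    latticeTheta A (fun i => (c i : ℝ) / 2) (-1 / τ) =
      (-I * τ) ^ k * latticeTheta A 0 (τ + 1) := by
  have h0 : τ ≠ 0 := fun h => by simp [h] at hτ
  rw [latticeTheta, tsum_exp_realForm_eq hA hdet hk (im_neg_one_div_pos hτ),
    latticeTheta_zero_add_one]
  congr 1
  · congr 1
    field_simp
  · refine tsum_congr fun m => ?_
    congr 1
    · simp
    · rw [← cexp_pi_I_mul_int_eq (hc m)]
      congr 1
      simp only [dotProduct, Int.cast_sum, Int.cast_mul, Finset.mul_sum]
      refine Finset.sum_congr rfl fun i _ => ?_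
      push_cast
      ring

end LatticeTheta

open Complex Filter Asymptotics in
/-- Triples of holomorphic functions on the upper half plane which transform like the `2k`-th
powers of the three Jacobi theta constants. -/
structure IsThetaTriple (k : ℕ) (f₁ f₂ f₃ : ℂ → ℂ) : Prop where
  differentiableOn₁ : DifferentiableOn ℂ f₁ {τ | 0 < τ.im}
  differentiableOn₂ : DifferentiableOn ℂ f₂ {τ | 0 < τ.im}
  differentiableOn₃ : DifferentiableOn ℂ f₃ {τ | 0 < τ.im}
  add_one₁ : ∀ τ : ℂ, 0 < τ.im → f₁ (τ + 1) = f₂ τ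
  add_one₂ : ∀ τ : ℂ, 0 < τ.im → f₂ (τ + 1) = f₁ τ
  add_one₃ : ∀ τ : ℂ, 0 < τ.im → f₃ (τ + 1) = I ^ k * f₃ τ
  neg_one_div₁ : ∀ τ : ℂ, 0 < τ.im → f₁ (-1 / τ) = (-I * τ) ^ k * f₁ τ
  neg_one_div₂ : ∀ τ : ℂ, 0 < τ.im → f₂ (-1 / τ) = (-I * τ) ^ k * f₃ τ
  neg_one_div₃ : ∀ τ : ℂ, 0 < τ.im → f₃ (-1 / τ) = (-I * τ) ^ k * f₂ τ
  isBigO₁ : f₁ =O[comap im atTop] fun _ => (1 : ℝ)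
  isBigO₂ : f₂ =O[comap im atTop] fun _ => (1 : ℝ)
  isBigO₃ : f₃ =O[comap im atTop] fun _ => (1 : ℝ)

section ThetaTriple

open Matrix Complex Filter Asymptotics

theorem IsThetaTriple.pow {k : ℕ} {f₁ f₂ f₃ : ℂ → ℂ} (hf : IsThetaTriple k f₁ f₂ f₃) (n : ℕ) :
    IsThetaTriple (k * n) (f₁ ^ n) (f₂ ^ n) (f₃ ^ n) where
  differentiableOn₁ := hf.differentiableOn₁.pow n
  differentiableOn₂ := hf.differentiableOn₂.pow n
  differentiableOn₃ := hf.differentiableOn₃.pow n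
  add_one₁ τ hτ := by simp [hf.add_one₁ τ hτ]
  add_one₂ τ hτ := by simp [hf.add_one₂ τ hτ]
  add_one₃ τ hτ := by simp [hf.add_one₃ τ hτ, mul_pow, pow_mul]
  neg_one_div₁ τ hτ := by simp only [Pi.pow_apply, hf.neg_one_div₁ τ hτ]; ring
  neg_one_div₂ τ hτ := by simp only [Pi.pow_apply, hf.neg_one_div₂ τ hτ]; ring
  neg_one_div₃ τ hτ := by simp only [Pi.pow_apply, hf.neg_one_div₃ τ hτ]; ring
  isBigO₁ := by simpa using hf.isBigO₁.pow n
  isBigO₂ := by simpa using hf.isBigO₂.pow n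
  isBigO₃ := by simpa using hf.isBigO₃.pow n

/-- The theta series of a unimodular lattice, its translate, and the theta series of the set of
halves of characteristic vectors form a theta triple. -/
theorem isThetaTriple_latticeTheta {ι : Type*} [Fintype ι] [DecidableEq ι] {A : Matrix ι ι ℤ}
    (hA : (A.map (Int.cast : ℤ → ℝ)).PosDef) (hdet : A.det = 1) {k : ℕ}
    (hk : Fintype.card ι = 2 * k) {c : ι → ℤ} (hc : IsCharacteristic A c) :
    IsThetaTriple k (latticeTheta A 0) (fun τ => latticeTheta A 0 (τ + 1))
      (latticeTheta A fun i => (c i : ℝ) / 2) := by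
  have hadd {τ : ℂ} (h : 0 < τ.im) : 0 < (τ + 1).im := by simpa using h
  have hne {τ : ℂ} (h : 0 < τ.im) : τ ≠ 0 := fun h0 => by simp [h0] at h
  have hbdd (w : ι → ℝ) : latticeTheta A w =O[comap im atTop] fun _ => (1 : ℝ) := by
    refine IsBigO.of_bound (∑' m : ι → ℤ, Real.exp (-(Real.pi * A.realForm (w + fun i =>
      (m i : ℝ))))) ((tendsto_comap.eventually (eventually_ge_atTop (1 : ℝ))).mono fun τ hτ => ?_)
    simpa using norm_latticeTheta_le_of_one_le hA hdet w hτ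
  have hS2 (τ : ℂ) (hτ : 0 < τ.im) : latticeTheta A 0 (-1 / τ + 1) =
      (-I * τ) ^ k * latticeTheta A (fun i => (c i : ℝ) / 2) τ := by
    have h := latticeTheta_half_neg_one_div hA hdet hk hc (im_neg_one_div_pos hτ)
    have h0 := hne hτ
    have h1 : -1 / (-1 / τ) = τ := by field_simp
    rw [h1] at h
    rw [h, ← mul_assoc, ← mul_pow]
    have : -I * τ * (-I * (-1 / τ)) = 1 := by
      field_simp
      simp
    rw [this, one_pow, one_mul]
  refine ⟨differentiableOn_latticeTheta hA hdet 0, ?_, differentiableOn_latticeTheta hA hdet _,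
    fun _ _ => rfl, fun τ _ => latticeTheta_zero_add_two τ, fun τ hτ => ?_,
    fun τ => latticeTheta_zero_neg_one_div hA hdet hk, hS2,
    fun τ => latticeTheta_half_neg_one_div hA hdet hk hc, hbdd 0, ?_, hbdd _⟩
  · exact (differentiableOn_latticeTheta hA hdet 0).comp (by fun_prop) fun τ hτ => hadd hτ
  · have h1 : 0 < (τ + 1).im := hadd hτ
    have h2 : 0 < (-1 / (τ + 1)).im := im_neg_one_div_pos h1
    have h3 : 0 < (-1 / τ).im := im_neg_one_div_pos hτ
    have n0 := hne hτ
    have n1 := hne h1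
    have e1 : τ + 1 = -1 / (-1 / (τ + 1)) := by field_simp
    have e2 : -1 / (τ + 1) + 1 = -1 / (-1 / τ - 1) := by
      have : -1 / τ - 1 ≠ 0 := by
        intro h
        apply n1
        field_simp at h
        linear_combination -h
      have n2 : -1 - τ ≠ 0 := fun h => n1 (by linear_combination -h)
      field_simp
      ring
    have h4 : 0 < (-1 / τ - 1).im := by simpa using h3
    have e3 : latticeTheta A 0 (-1 / τ - 1) = latticeTheta A 0 (-1 / τ + 1) := by
      rw [← latticeTheta_zero_add_two]
      congr 1
      ring
    rw [e1, latticeTheta_half_neg_one_div hA hdet hk hc h2, e2,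
      latticeTheta_zero_neg_one_div hA hdet hk h4, e3, hS2 τ hτ, ← mul_assoc, ← mul_assoc,
      ← mul_pow, ← mul_pow]
    congr 2
    field_simp
    linear_combination -(τ + 1) * I_sq
  · refine IsBigO.of_bound (∑' m : ι → ℤ, Real.exp (-(Real.pi * A.realForm (0 + fun i =>
      (m i : ℝ))))) ((tendsto_comap.eventually (eventually_ge_atTop (1 : ℝ))).mono fun τ hτ => ?_)
    simpa only [norm_one, mul_one] using
      norm_latticeTheta_le_of_one_le hA hdet 0 (τ := τ + 1) (by simpa using hτ)

theorem IsCharacteristic.norm_add_two_smul {ι : Type*} [Fintype ι] {A : Matrix ι ι ℤ}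
    (hsymm : A.IsSymm) {c : ι → ℤ} (hc : IsCharacteristic A c) (m : ι → ℤ) :
    (8 : ℤ) ∣ (c + 2 • m) ⬝ᵥ A *ᵥ (c + 2 • m) - c ⬝ᵥ A *ᵥ c := by
  obtain ⟨n, hn⟩ := hc m
  have h1 : m ⬝ᵥ A *ᵥ c = c ⬝ᵥ A *ᵥ m := by
    rw [dotProduct_mulVec, ← mulVec_transpose, hsymm.eq, dotProduct_comm]
  refine ⟨n + m ⬝ᵥ A *ᵥ m, ?_⟩
  simp only [mulVec_add, mulVec_smul, dotProduct_add, add_dotProduct, dotProduct_smul,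
    smul_dotProduct, h1]
  simp only [nsmul_eq_mul]
  push_cast
  linear_combination 4 * hn

/-- The norm of a characteristic vector is congruent to the rank modulo `8`. -/
theorem IsCharacteristic.norm_modEq {ι : Type*} [Fintype ι] [DecidableEq ι] {A : Matrix ι ι ℤ}
    (hA : (A.map (Int.cast : ℤ → ℝ)).PosDef) (hsymm : A.IsSymm) (hdet : A.det = 1) {k : ℕ}
    (hk : Fintype.card ι = 2 * k) {c : ι → ℤ} (hc : IsCharacteristic A c) :
    c ⬝ᵥ A *ᵥ c ≡ 2 * k [ZMOD 8] := by
  have hI : 0 < I.im := by simp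
  have h1 := (isThetaTriple_latticeTheta hA hdet hk hc).add_one₃ I hI
  have h2 : latticeTheta A (fun i => (c i : ℝ) / 2) (I + 1) =
      cexp (Real.pi * I / 4 * (c ⬝ᵥ A *ᵥ c : ℤ)) *
        latticeTheta A (fun i => (c i : ℝ) / 2) I := by
    rw [latticeTheta, latticeTheta, ← tsum_mul_left]
    refine tsum_congr fun m => ?_
    obtain ⟨n, hn⟩ := hc.norm_add_two_smul hsymm m
    rw [realForm_half_add, ← Complex.exp_add, exp_eq_exp_iff_exists_int]
    refine ⟨n, ?_⟩
    rw [eq_add_of_sub_eq' hn]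
    push_cast
    ring
  have h3 : latticeTheta A (fun i => (c i : ℝ) / 2) I ≠ 0 := by
    have : latticeTheta A (fun i => (c i : ℝ) / 2) I = ((∑' m : ι → ℤ, Real.exp
        (-(Real.pi * A.realForm ((fun i => (c i : ℝ) / 2) + fun i => (m i : ℝ)))) : ℝ) : ℂ) := by
      rw [ofReal_tsum]
      refine tsum_congr fun m => ?_
      rw [ofReal_exp]
      congr 1
      push_cast
      linear_combination Real.pi *
        (A.realForm ((fun i => (c i : ℝ) / 2) + fun i => (m i : ℝ)) : ℂ) * I_mul_I
    rw [this, ofReal_ne_zero]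
    exact ((summable_exp_neg_realForm hA hdet Real.pi_pos _).tsum_pos
      (fun m => (Real.exp_pos _).le) 0 (Real.exp_pos _)).ne'
  have h4 := mul_right_cancel₀ h3 (h2.symm.trans h1)
  have h5 : I ^ k = cexp (Real.pi * I / 2 * k) := by
    rw [mul_comm _ (k : ℂ), Complex.exp_nat_mul, mul_div_right_comm, Complex.exp_pi_div_two_mul_I]
  rw [h5, exp_eq_exp_iff_exists_int] at h4
  obtain ⟨n, hn⟩ := h4
  have h6 : ((c ⬝ᵥ A *ᵥ c : ℤ) : ℂ) = ((2 * k + 8 * n : ℤ) : ℂ) := by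
    have : (Real.pi * I : ℂ) ≠ 0 := by simp [Real.pi_ne_zero]
    apply mul_left_cancel₀ this
    push_cast
    linear_combination 4 * hn
  rw [Int.cast_inj] at h6
  rw [h6]
  exact Int.modEq_iff_dvd.2 ⟨-n, by ring⟩

end ThetaTriple

section CuspForm

open Complex Filter Asymptotics UpperHalfPlane

/-- A combination of two theta triples which is invariant under the modular group. -/
def thetaCombination (f₁ f₂ f₃ h₁ h₂ h₃ : ℂ → ℂ) : ℂ → ℂ :=
  f₁ * h₁ ^ 3 * (h₂ * h₃) ^ 4 * (h₂ ^ 2 - h₃ ^ 2) +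
    f₂ * h₂ ^ 3 * (h₃ * h₁) ^ 4 * (h₁ ^ 2 + h₃ ^ 2) -
    f₃ * h₃ ^ 3 * (h₁ * h₂) ^ 4 * (h₁ ^ 2 + h₂ ^ 2)

variable {f₁ f₂ f₃ h₁ h₂ h₃ : ℂ → ℂ}

theorem thetaCombination_add_one (hf : IsThetaTriple 13 f₁ f₂ f₃) (hh : IsThetaTriple 1 h₁ h₂ h₃)
    {τ : ℂ} (hτ : 0 < τ.im) : thetaCombination f₁ f₂ f₃ h₁ h₂ h₃ (τ + 1) =
      thetaCombination f₁ f₂ f₃ h₁ h₂ h₃ τ := by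
  have h13 : Complex.I ^ 13 = Complex.I := by
    rw [show 13 = 4 * 3 + 1 from rfl, pow_succ, pow_mul, Complex.I_pow_four]
    simp
  simp only [thetaCombination, Pi.add_apply, Pi.sub_apply, Pi.mul_apply, Pi.pow_apply,
    hf.add_one₁ τ hτ, hf.add_one₂ τ hτ, hf.add_one₃ τ hτ, hh.add_one₁ τ hτ, hh.add_one₂ τ hτ,
    hh.add_one₃ τ hτ, h13, mul_pow, pow_one, Complex.I_pow_four, Complex.I_sq]
  linear_combination -(f₃ τ * h₃ τ ^ 3 * h₁ τ ^ 4 * h₂ τ ^ 4 * (h₁ τ ^ 2 + h₂ τ ^ 2)) *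
    Complex.I_pow_four

theorem thetaCombination_neg_one_div (hf : IsThetaTriple 13 f₁ f₂ f₃)
    (hh : IsThetaTriple 1 h₁ h₂ h₃) {τ : ℂ} (hτ : 0 < τ.im) :
    thetaCombination f₁ f₂ f₃ h₁ h₂ h₃ (-1 / τ) =
      τ ^ 26 * thetaCombination f₁ f₂ f₃ h₁ h₂ h₃ τ := by
  have h26 : (-Complex.I * τ) ^ 26 = -τ ^ 26 := by
    rw [mul_pow, show 26 = 2 * 13 from rfl, pow_mul, neg_sq, Complex.I_sq]
    ring
  simp only [thetaCombination, Pi.add_apply, Pi.sub_apply, Pi.mul_apply, Pi.pow_apply,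
    hf.neg_one_div₁ τ hτ, hf.neg_one_div₂ τ hτ, hf.neg_one_div₃ τ hτ, hh.neg_one_div₁ τ hτ,
    hh.neg_one_div₂ τ hτ, hh.neg_one_div₃ τ hτ, pow_one]
  generalize -Complex.I * τ = x at *
  linear_combination (-(f₁ τ * h₁ τ ^ 3 * (h₂ τ * h₃ τ) ^ 4 * (h₂ τ ^ 2 - h₃ τ ^ 2) +
    f₂ τ * h₂ τ ^ 3 * (h₃ τ * h₁ τ) ^ 4 * (h₁ τ ^ 2 + h₃ τ ^ 2) -
    f₃ τ * h₃ τ ^ 3 * (h₁ τ * h₂ τ) ^ 4 * (h₁ τ ^ 2 + h₂ τ ^ 2))) * h26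

theorem tendsto_thetaCombination (hf : IsThetaTriple 13 f₁ f₂ f₃)
    (hh : IsThetaTriple 1 h₁ h₂ h₃) (h0 : Tendsto h₃ (comap Complex.im atTop) (nhds 0)) :
    Tendsto (thetaCombination f₁ f₂ f₃ h₁ h₂ h₃) (comap Complex.im atTop) (nhds 0) := by
  have key : thetaCombination f₁ f₂ f₃ h₁ h₂ h₃ =
      h₃ * (f₁ * h₁ ^ 3 * (h₂ ^ 4 * h₃ ^ 3) * (h₂ ^ 2 - h₃ ^ 2) +
        f₂ * h₂ ^ 3 * (h₃ ^ 3 * h₁ ^ 4) * (h₁ ^ 2 + h₃ ^ 2) -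
        f₃ * h₃ ^ 2 * (h₁ * h₂) ^ 4 * (h₁ ^ 2 + h₂ ^ 2)) := by
    unfold thetaCombination
    ring
  have hm {u v : ℂ → ℂ} (hu : u =O[comap Complex.im atTop] fun _ => (1 : ℝ))
      (hv : v =O[comap Complex.im atTop] fun _ => (1 : ℝ)) :
      (u * v) =O[comap Complex.im atTop] fun _ => (1 : ℝ) := by
    simpa using hu.mul hv
  have hp {u : ℂ → ℂ} (hu : u =O[comap Complex.im atTop] fun _ => (1 : ℝ)) (n : ℕ) :
      (u ^ n) =O[comap Complex.im atTop] fun _ => (1 : ℝ) := by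
    simpa using hu.pow n
  have e1 := hh.isBigO₁
  have e2 := hh.isBigO₂
  have e3 := hh.isBigO₃
  rw [key, ← isLittleO_one_iff ℝ]
  have := ((isLittleO_one_iff ℝ).2 h0).mul_isBigO
    (((hm (hm (hm hf.isBigO₁ (hp e1 3)) (hm (hp e2 4) (hp e3 3))) ((hp e2 2).sub (hp e3 2))).add
      (hm (hm (hm hf.isBigO₂ (hp e2 3)) (hm (hp e3 3) (hp e1 4))) ((hp e1 2).add (hp e3 2)))).sub
      (hm (hm (hm hf.isBigO₃ (hp e3 2)) (hp (hm e1 e2) 4)) ((hp e1 2).add (hp e2 2))))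
  simp only [mul_one] at this
  exact this

theorem differentiableOn_thetaCombination (hf : IsThetaTriple 13 f₁ f₂ f₃)
    (hh : IsThetaTriple 1 h₁ h₂ h₃) :
    DifferentiableOn ℂ (thetaCombination f₁ f₂ f₃ h₁ h₂ h₃) {τ | 0 < τ.im} := by
  have a1 := hf.differentiableOn₁
  have a2 := hf.differentiableOn₂
  have a3 := hf.differentiableOn₃
  have b1 := hh.differentiableOn₁
  have b2 := hh.differentiableOn₂
  have b3 := hh.differentiableOn₃
  exact ((((a1.mul (b1.pow 3)).mul ((b2.mul b3).pow 4)).mul ((b2.pow 2).sub (b3.pow 2))).add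
    (((a2.mul (b2.pow 3)).mul ((b3.mul b1).pow 4)).mul ((b1.pow 2).add (b3.pow 2)))).sub
    (((a3.mul (b3.pow 3)).mul ((b1.mul b2).pow 4)).mul ((b1.pow 2).add (b2.pow 2)))

open ModularGroup MatrixGroups ModularForm in
/-- `thetaCombination` defines a cusp form of weight `26`. -/
theorem exists_cuspForm_eq_thetaCombination (hf : IsThetaTriple 13 f₁ f₂ f₃)
    (hh : IsThetaTriple 1 h₁ h₂ h₃) (h0 : Tendsto h₃ (comap Complex.im atTop) (nhds 0)) :
    ∃ F : CuspForm 𝒮ℒ 26, ∀ τ : ℍ, F τ = thetaCombination f₁ f₂ f₃ h₁ h₂ h₃ τ := by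
  set F : ℍ → ℂ := fun τ => thetaCombination f₁ f₂ f₃ h₁ h₂ h₃ τ with hF
  have hS : F ∣[(26 : ℤ)] S = F := by
    ext z
    rw [SL_slash_apply, UpperHalfPlane.modular_S_smul]
    have h1 := thetaCombination_neg_one_div hf hh z.im_pos
    have h2 : (z : ℂ) ^ 26 ≠ 0 := pow_ne_zero _ z.ne_zero
    have h3 : thetaCombination f₁ f₂ f₃ h₁ h₂ h₃ (-(z : ℂ))⁻¹ =
        (z : ℂ) ^ 26 * thetaCombination f₁ f₂ f₃ h₁ h₂ h₃ z := by
      rw [← h1]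
      congr 1
      rw [inv_neg, neg_div, one_div]
    rw [ModularGroup.denom_apply, ModularGroup.S]
    simp only [hF, h3]
    have h4 := z.ne_zero
    simp
    field_simp
  have hT : F ∣[(26 : ℤ)] T = F := by
    ext z
    rw [SL_slash_apply, modular_T_smul, ModularGroup.denom_apply, ModularGroup.T]
    have := thetaCombination_add_one hf hh z.im_pos
    simp [hF, add_comm (1 : ℂ), this]
  refine ⟨⟨⟨F, ?_⟩, ?_, ?_⟩, fun τ => rfl⟩
  · rintro A ⟨A, rfl⟩
    exact SlashInvariantForm.slash_action_generators_SL2Z hS hT A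
  · rw [UpperHalfPlane.mdifferentiable_iff]
    refine (differentiableOn_thetaCombination hf hh).congr fun z hz => ?_
    simp [hF, ofComplex_apply_of_im_pos hz]
  · intro c hc
    rw [Subgroup.IsArithmetic.isCusp_iff_isCusp_SL2Z] at hc
    rw [OnePoint.isZeroAt_iff_forall_SL2Z hc]
    intro γ _
    rw [SlashInvariantForm.slash_action_generators_SL2Z hS hT]
    exact (tendsto_thetaCombination hf hh h0).comp UpperHalfPlane.tendsto_coe_atImInfty

open MatrixGroups in
theorem finrank_cuspForm_weight_twentysix : Module.finrank ℂ (CuspForm 𝒮ℒ 26) = 1 := by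
  have h1 : Module.rank ℂ (CuspForm 𝒮ℒ 26) = Module.rank ℂ (ModularForm 𝒮ℒ (14 : ℕ)) :=
    CuspForm.discriminantEquiv.rank_eq
  have h2 : Module.rank ℂ (CuspForm 𝒮ℒ (14 : ℕ)) = Module.rank ℂ (ModularForm 𝒮ℒ 2) :=
    CuspForm.discriminantEquiv.rank_eq
  rw [Module.finrank, h1, ModularForm.rank_eq_one_add_rank_cuspForm (by norm_num) (by decide), h2,
    ModularForm.levelOne_weight_two_rank_zero]
  simp

/-- Since there is only one cusp form of weight `26` up to scalars, so is there only one
`thetaCombination`. -/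
theorem exists_thetaCombination_eq_mul {g₁ g₂ g₃ : ℂ → ℂ} (hf : IsThetaTriple 13 f₁ f₂ f₃)
    (hg : IsThetaTriple 13 g₁ g₂ g₃) (hh : IsThetaTriple 1 h₁ h₂ h₃)
    (h0 : Tendsto h₃ (comap Complex.im atTop) (nhds 0)) {τ₀ : ℂ} (hτ₀ : 0 < τ₀.im)
    (hne : thetaCombination g₁ g₂ g₃ h₁ h₂ h₃ τ₀ ≠ 0) :
    ∃ a : ℂ, ∀ τ : ℂ, 0 < τ.im → thetaCombination f₁ f₂ f₃ h₁ h₂ h₃ τ =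
      a * thetaCombination g₁ g₂ g₃ h₁ h₂ h₃ τ := by
  obtain ⟨F, hF⟩ := exists_cuspForm_eq_thetaCombination hf hh h0
  obtain ⟨G, hG⟩ := exists_cuspForm_eq_thetaCombination hg hh h0
  have hG0 : G ≠ 0 := by
    rintro rfl
    exact hne (by simpa using (hG ⟨τ₀, hτ₀⟩).symm)
  obtain ⟨a, ha⟩ := exists_smul_eq_of_finrank_eq_one finrank_cuspForm_weight_twentysix hG0 F
  refine ⟨a, fun τ hτ => ?_⟩
  have h1 := hF ⟨τ, hτ⟩
  have h2 := hG ⟨τ, hτ⟩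
  rw [← ha] at h1
  simp only at h1 h2
  rw [← h1, ← h2]
  rfl

end CuspForm

section Jet

open Filter Asymptotics Topology

/-- The function `u` satisfies `u x = a + b x + c x ^ 2 + O(x ^ 3)` at zero. -/
def HasJet (u : ℝ → ℝ) (a b c : ℝ) : Prop :=
  (fun x => u x - (a + b * x + c * x ^ 2)) =O[𝓝 0] fun x => x ^ 3

namespace HasJet

variable {u v : ℝ → ℝ} {a b c a' b' c' : ℝ}

theorem id : HasJet (fun x => x) 0 1 0 := by
  simp [HasJet, isBigO_zero]

theorem const (a : ℝ) : HasJet (fun _ => a) a 0 0 := by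
  simp [HasJet, isBigO_zero]

theorem comp_neg (hu : HasJet u a b c) : HasJet (fun x => u (-x)) a (-b) c := by
  have h : Tendsto (fun x : ℝ => -x) (𝓝 0) (𝓝 0) := by
    simpa using (continuous_neg (G := ℝ)).tendsto 0
  have := (IsBigO.comp_tendsto hu h).neg_right
  refine this.congr (fun x => ?_) fun x => ?_
  · simp
  · simp
    ring

theorem add (hu : HasJet u a b c) (hv : HasJet v a' b' c') :
    HasJet (fun x => u x + v x) (a + a') (b + b') (c + c') :=
  (IsBigO.add hu hv).congr_left fun x => by ring

theorem sub (hu : HasJet u a b c) (hv : HasJet v a' b' c') :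
    HasJet (fun x => u x - v x) (a - a') (b - b') (c - c') :=
  (IsBigO.sub hu hv).congr_left fun x => by ring

theorem isBigO_one_of_continuous (hu : Continuous u) : u =O[𝓝 0] fun _ => (1 : ℝ) :=
  (hu.tendsto 0).isBigO_one ℝ

theorem isBigO_one (hu : HasJet u a b c) : u =O[𝓝 0] fun _ => (1 : ℝ) := by
  have h1 : (fun x : ℝ => x ^ 3) =O[𝓝 0] fun _ => (1 : ℝ) :=
    isBigO_one_of_continuous (by fun_prop)
  have h2 : (fun x : ℝ => a + b * x + c * x ^ 2) =O[𝓝 0] fun _ => (1 : ℝ) :=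
    isBigO_one_of_continuous (by fun_prop)
  exact ((IsBigO.trans hu h1).add h2).congr_left fun x => by ring

theorem mul (hu : HasJet u a b c) (hv : HasJet v a' b' c') :
    HasJet (fun x => u x * v x) (a * a') (a * b' + b * a') (a * c' + b * b' + c * a') := by
  have h1 : (fun x => (u x - (a + b * x + c * x ^ 2)) * v x) =O[𝓝 0] fun x => x ^ 3 := by
    simpa using IsBigO.mul hu hv.isBigO_one
  have h2 : (fun x => (a + b * x + c * x ^ 2) * (v x - (a' + b' * x + c' * x ^ 2)))
      =O[𝓝 0] fun x => x ^ 3 := by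
    simpa using (isBigO_one_of_continuous (u := fun x : ℝ => a + b * x + c * x ^ 2)
      (by fun_prop)).mul hv
  have h3 : (fun x : ℝ => x ^ 3 * (b * c' + c * b' + c * c' * x)) =O[𝓝 0] fun x => x ^ 3 := by
    simpa using (isBigO_refl (fun x : ℝ => x ^ 3) (𝓝 0)).mul (isBigO_one_of_continuous
      (u := fun x : ℝ => b * c' + c * b' + c * c' * x) (by fun_prop))
  exact ((h1.add h2).add h3).congr_left fun x => by ring

theorem sq (hu : HasJet u a b c) :
    HasJet (fun x => u x ^ 2) (a ^ 2) (2 * a * b) (2 * a * c + b ^ 2) := by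
  convert hu.mul hu using 1
  · ext x; ring
  all_goals ring

theorem pow_four (hu : HasJet u a b c) :
    HasJet (fun x => u x ^ 4) (a ^ 4) (4 * a ^ 3 * b) (4 * a ^ 3 * c + 6 * a ^ 2 * b ^ 2) := by
  convert hu.sq.sq using 1
  · ext x; ring
  all_goals ring

theorem pow_three (hu : HasJet u a b c) :
    HasJet (fun x => u x ^ 3) (a ^ 3) (3 * a ^ 2 * b) (3 * a ^ 2 * c + 3 * a * b ^ 2) := by
  convert hu.sq.mul hu using 1
  · ext x; ring
  all_goals ring

theorem congr_coeff (hu : HasJet u a b c) (h₁ : a = a') (h₂ : b = b') (h₃ : c = c') :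
    HasJet u a' b' c' := by
  rwa [← h₁, ← h₂, ← h₃]

theorem eq_zero_of_abs_le {C : ℝ} (h : ∀ᶠ x in 𝓝[>] (0 : ℝ), |a + b * x + c * x ^ 2| ≤ C * x) :
    a = 0 := by
  have h1 : Tendsto (fun x : ℝ => |a + b * x + c * x ^ 2|) (𝓝[>] 0) (𝓝 |a|) := by
    have : Continuous fun x : ℝ => |a + b * x + c * x ^ 2| := by fun_prop
    simpa using (this.tendsto 0).mono_left nhdsWithin_le_nhds
  have h2 : Tendsto (fun x : ℝ => C * x) (𝓝[>] 0) (𝓝 0) := by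
    have : Continuous fun x : ℝ => C * x := by fun_prop
    simpa using (this.tendsto 0).mono_left nhdsWithin_le_nhds
  exact abs_nonpos_iff.1 (le_of_tendsto_of_tendsto h1 h2 h)

/-- The coefficients of a jet are unique. -/
theorem eq_zero (hu : HasJet u a b c) (h : ∀ᶠ x in 𝓝[>] (0 : ℝ), u x = 0) :
    a = 0 ∧ b = 0 ∧ c = 0 := by
  obtain ⟨C, hC⟩ := IsBigO.bound hu
  have hpos : ∀ᶠ x : ℝ in 𝓝[>] 0, 0 < x := eventually_mem_nhdsWithin
  have hlt : ∀ᶠ x : ℝ in 𝓝[>] 0, x < 1 :=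
    nhdsWithin_le_nhds (eventually_lt_nhds zero_lt_one)
  have hC' : ∀ᶠ x in 𝓝[>] (0 : ℝ), |a + b * x + c * x ^ 2| ≤ |C| * x ^ 3 := by
    filter_upwards [h, hpos, nhdsWithin_le_nhds hC] with x h0 hx h1
    rw [h0, zero_sub, norm_neg, Real.norm_eq_abs, Real.norm_eq_abs, abs_of_pos (pow_pos hx 3)] at h1
    exact h1.trans (by gcongr; exact le_abs_self C)
  have ha : a = 0 := by
    refine eq_zero_of_abs_le (b := b) (c := c) (C := |C|) ?_
    filter_upwards [hC', hpos, hlt] with x h1 hx hx1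
    refine h1.trans (mul_le_mul_of_nonneg_left ?_ (abs_nonneg C))
    nlinarith [mul_pos hx hx]
  have hb : b = 0 := by
    refine eq_zero_of_abs_le (b := c) (c := 0) (C := |C|) ?_
    filter_upwards [hC', hpos, hlt] with x h1 hx hx1
    rw [ha, show 0 + b * x + c * x ^ 2 = x * (b + c * x + 0 * x ^ 2) by ring, abs_mul,
      abs_of_pos hx, show |C| * x ^ 3 = x * (|C| * x ^ 2) by ring, mul_le_mul_iff_right₀ hx] at h1
    refine h1.trans (mul_le_mul_of_nonneg_left ?_ (abs_nonneg C))
    nlinarith [mul_pos hx hx]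
  refine ⟨ha, hb, eq_zero_of_abs_le (b := 0) (c := 0) (C := |C|) ?_⟩
  filter_upwards [hC', hpos] with x h1 hx
  rw [ha, hb, show 0 + 0 * x + c * x ^ 2 = x ^ 2 * (c + 0 * x + 0 * x ^ 2) by ring, abs_mul,
    abs_of_pos (pow_pos hx 2), show |C| * x ^ 3 = x ^ 2 * (|C| * x) by ring,
    mul_le_mul_iff_right₀ (pow_pos hx 2)] at h1
  exact h1

end HasJet

/-- The first coefficients of a generating series. -/
theorem hasJet_tsum_pow {X : Type*} {N : X → ℕ} {r : ℝ} (hr : 0 < r)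
    (hN : Summable fun m => r ^ N m) :
    HasJet (fun x => ∑' m, x ^ N m) (Nat.card {m // N m = 0}) (Nat.card {m // N m = 1})
      (Nat.card {m // N m = 2}) := by
  have hs {x : ℝ} (hx : |x| ≤ r) : Summable fun m => x ^ N m := by
    refine .of_norm_bounded hN fun m => ?_
    rw [Real.norm_eq_abs, abs_pow]
    gcongr
  have hi (x : ℝ) (n : ℕ) : (∑' m, if N m = n then x ^ n else 0) =
      Nat.card {m // N m = n} * x ^ n := by
    have := tsum_subtype {m | N m = n} fun _ => x ^ n
    rw [tsum_const, nsmul_eq_mul] at this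
    rw [← Set.coe_ofPred, this]
    exact tsum_congr fun m => by simp [Set.indicator_apply]
  have hfin (n : ℕ) : {m | N m = n}.Finite := by
    have h1 := (hN.tendsto_cofinite_zero.eventually (gt_mem_nhds (pow_pos hr n)))
    rw [eventually_cofinite] at h1
    exact h1.subset fun m (hm : N m = n) => by simp [hm]
  have hsi (x : ℝ) (n : ℕ) : Summable fun m => if N m = n then x ^ n else 0 :=
    summable_of_hasFiniteSupport ((hfin n).subset fun m hm => by
      by_contra h
      simp_all)
  refine IsBigO.of_bound (∑' m, r ^ N m / r ^ 3) ?_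
  have hev : ∀ᶠ x : ℝ in 𝓝 0, |x| < r :=
    (continuous_abs.tendsto 0).eventually_lt_const (by simpa using hr)
  filter_upwards [hev] with x hx
  have h1 : (∑' m, x ^ N m) - ((Nat.card {m // N m = 0} : ℝ) + Nat.card {m // N m = 1} * x +
      Nat.card {m // N m = 2} * x ^ 2) = ∑' m, (x ^ N m - ((if N m = 0 then x ^ 0 else 0) +
        (if N m = 1 then x ^ 1 else 0) + if N m = 2 then x ^ 2 else 0)) := by
    rw [(hs hx.le).tsum_sub (((hsi x 0).add (hsi x 1)).add (hsi x 2)),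
      ((hsi x 0).add (hsi x 1)).tsum_add (hsi x 2), (hsi x 0).tsum_add (hsi x 1),
      hi, hi, hi, pow_zero, pow_one, mul_one]
  rw [h1, tsum_div_const, Real.norm_eq_abs (x ^ 3), abs_pow, div_mul_eq_mul_div, mul_div_assoc,
    ← tsum_mul_right]
  refine tsum_of_norm_bounded (hN.mul_right _).hasSum fun m => ?_
  obtain h | h | h | h : N m = 0 ∨ N m = 1 ∨ N m = 2 ∨ 3 ≤ N m := by omega
  · simp [h]; positivity
  · simp [h]; positivity
  · simp [h]; positivity
  · obtain ⟨j, hj⟩ := Nat.exists_eq_add_of_le h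
    rw [if_neg (by omega), if_neg (by omega), if_neg (by omega), hj]
    simp only [add_zero, sub_zero, norm_pow, Real.norm_eq_abs]
    rw [pow_add, pow_add, mul_comm]
    have : r ^ 3 * r ^ j * (|x| ^ 3 / r ^ 3) = r ^ j * |x| ^ 3 := by
      field_simp
    rw [this]
    gcongr

end Jet

section Expansion

open Filter Topology Matrix

/-- Expansions of the members of a theta triple along the imaginary axis. -/
def HasThetaJet (f₁ f₂ f₃ : ℂ → ℂ) (n₁ n₂ b₀ b₂ : ℝ) : Prop :=
  ∃ P R : ℝ → ℝ, HasJet P 1 n₁ n₂ ∧ HasJet R b₀ 0 b₂ ∧ ∀ t : ℝ, 0 < t →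
    f₁ (Complex.I * t) = P (Real.exp (-(Real.pi * t))) ∧
    f₂ (Complex.I * t) = P (-Real.exp (-(Real.pi * t))) ∧
    f₃ (Complex.I * t) = (Real.exp (-(Real.pi * t / 2)) * R (Real.exp (-(Real.pi * t))) : ℝ)

variable {f₁ f₂ f₃ h₁ h₂ h₃ : ℂ → ℂ} {n₁ n₂ b₀ b₂ : ℝ}

theorem HasThetaJet.pow_thirteen (hh : HasThetaJet h₁ h₂ h₃ 4 4 4 8) :
    HasThetaJet (h₁ ^ 13) (h₂ ^ 13) (h₃ ^ 13) 52 1300 0 0 := by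
  obtain ⟨P, R, hP, hR, hPR⟩ := hh
  refine ⟨fun x => ((P x ^ 3) ^ 4) * P x, fun x => (x * x) * (x ^ 4 * (((R x ^ 3) ^ 4) * R x)),
    ((hP.pow_three.pow_four.mul hP).congr_coeff (by norm_num) (by norm_num) (by norm_num)),
    (((HasJet.id.mul HasJet.id).mul
      (HasJet.id.pow_four.mul (hR.pow_three.pow_four.mul hR))).congr_coeff
      (by norm_num) (by norm_num) (by norm_num)), fun t ht => ?_⟩
  obtain ⟨e1, e2, e3⟩ := hPR t ht
  simp only [Pi.pow_apply, e1, e2, e3]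
  refine ⟨by push_cast; ring, by push_cast; ring, ?_⟩
  have : Real.exp (-(Real.pi * t)) = Real.exp (-(Real.pi * t / 2)) ^ 2 := by
    rw [← Real.exp_nat_mul]
    congr 1
    push_cast
    ring
  generalize R (Real.exp (-(Real.pi * t))) = y
  rw [this]
  push_cast
  ring

theorem thetaCombination_expansion (hf : HasThetaJet f₁ f₂ f₃ n₁ n₂ b₀ b₂)
    (hh : HasThetaJet h₁ h₂ h₃ 4 4 4 8) :
    ∃ G : ℝ → ℝ, HasJet G (512 - 128 * b₀) 0
        (512 * (n₂ - 28 * n₁ + 108) - 128 * (b₂ - 2 * b₀)) ∧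
      ∀ t : ℝ, 0 < t → thetaCombination f₁ f₂ f₃ h₁ h₂ h₃ (Complex.I * t) =
        (Real.exp (-(Real.pi * t)) ^ 2 * G (Real.exp (-(Real.pi * t))) : ℝ) := by
  obtain ⟨P, R, hP, hR, hPR⟩ := hf
  obtain ⟨p, r, hp, hr, hpr⟩ := hh
  have hPn := hP.comp_neg
  have hpn := hp.comp_neg
  have j1 : HasJet (fun x => p x ^ 3 * (p (-x) * r x) ^ 4 * (p (-x) ^ 2 - x * r x ^ 2))
      256 (256 * -28) (256 * 108) :=
    ((hp.pow_three.mul (hpn.mul hr).pow_four).mul (hpn.sq.sub (HasJet.id.mul hr.sq))).congr_coeff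
      (by norm_num) (by norm_num) (by norm_num)
  have j2 : HasJet (fun x => p (-x) ^ 3 * (r x * p x) ^ 4 * (p x ^ 2 + x * r x ^ 2))
      256 (256 * 28) (256 * 108) :=
    ((hpn.pow_three.mul (hr.mul hp).pow_four).mul (hp.sq.add (HasJet.id.mul hr.sq))).congr_coeff
      (by norm_num) (by norm_num) (by norm_num)
  have j3 : HasJet (fun x => r x ^ 3 * (p x * p (-x)) ^ 4 * (p x ^ 2 + p (-x) ^ 2))
      128 0 (-256) :=
    ((hr.pow_three.mul (hp.mul hpn).pow_four).mul (hp.sq.add hpn.sq)).congr_coeff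
      (by norm_num) (by norm_num) (by norm_num)
  refine ⟨_, ((((hP.mul j1).add (hPn.mul j2)).sub (hR.mul j3)).congr_coeff
    (by ring) (by ring) (by ring)), fun t ht => ?_⟩
  obtain ⟨e1, e2, e3⟩ := hPR t ht
  obtain ⟨d1, d2, d3⟩ := hpr t ht
  simp only [thetaCombination, Pi.add_apply, Pi.sub_apply, Pi.mul_apply, Pi.pow_apply, e1, e2, e3,
    d1, d2, d3]
  have : Real.exp (-(Real.pi * t)) = Real.exp (-(Real.pi * t / 2)) ^ 2 := by
    rw [← Real.exp_nat_mul]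
    congr 1
    push_cast
    ring
  generalize P (Real.exp (-(Real.pi * t))) = P₁
  generalize P (-Real.exp (-(Real.pi * t))) = P₂
  generalize R (Real.exp (-(Real.pi * t))) = R₁
  generalize p (Real.exp (-(Real.pi * t))) = p₁
  generalize p (-Real.exp (-(Real.pi * t))) = p₂
  generalize r (Real.exp (-(Real.pi * t))) = r₁
  rw [this]
  generalize Real.exp (-(Real.pi * t / 2)) = s
  push_cast
  ring

/-- The relation between the numbers of short vectors of a unimodular lattice of rank `26` and
those of short characteristic vectors. -/
theorem IsThetaTriple.jet_relation (hf : IsThetaTriple 13 f₁ f₂ f₃)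
    (hh : IsThetaTriple 1 h₁ h₂ h₃) (h0 : Tendsto h₃ (comap Complex.im atTop) (nhds 0))
    (hfj : HasThetaJet f₁ f₂ f₃ n₁ n₂ b₀ b₂) (hhj : HasThetaJet h₁ h₂ h₃ 4 4 4 8) :
    b₂ = 624 + 4 * n₂ - 112 * n₁ - 46 * b₀ := by
  obtain ⟨G, hG, hGF⟩ := thetaCombination_expansion hfj hhj
  obtain ⟨K, hK, hKF⟩ := thetaCombination_expansion hhj.pow_thirteen hhj
  have hev : ∀ᶠ x : ℝ in 𝓝[>] 0, ∃ t : ℝ, 0 < t ∧ x = Real.exp (-(Real.pi * t)) := by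
    filter_upwards [Ioo_mem_nhdsGT zero_lt_one] with x hx
    refine ⟨-Real.log x / Real.pi, div_pos (neg_pos.2 (Real.log_neg hx.1 hx.2)) Real.pi_pos, ?_⟩
    rw [mul_div_cancel₀ _ Real.pi_ne_zero, neg_neg, Real.exp_log hx.1]
  have hex : ∃ τ : ℂ, 0 < τ.im ∧
      thetaCombination (h₁ ^ 13) (h₂ ^ 13) (h₃ ^ 13) h₁ h₂ h₃ τ ≠ 0 := by
    by_contra! hcon
    have := hK.eq_zero (hev.mono fun x ⟨t, ht, hx⟩ => by
      have h1 := (hKF t ht).symm.trans (hcon (Complex.I * t) (by simpa using ht))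
      rw [Complex.ofReal_eq_zero] at h1
      rw [hx]
      exact (mul_eq_zero.1 h1).resolve_left (pow_ne_zero _ (Real.exp_pos _).ne'))
    norm_num at this
  obtain ⟨τ₀, hτ₀, hne⟩ := hex
  obtain ⟨a, ha⟩ := exists_thetaCombination_eq_mul hf (hh.pow 13) hh h0 hτ₀ hne
  have := (hG.sub ((HasJet.const a.re).mul hK)).eq_zero (hev.mono fun x ⟨t, ht, hx⟩ => by
    have h1 := ha (Complex.I * t) (by simpa using ht)
    rw [hGF t ht, hKF t ht] at h1
    have h2 := congrArg Complex.re h1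
    rw [Complex.ofReal_re, Complex.re_mul_ofReal] at h2
    rw [hx]
    have h3 : Real.exp (-(Real.pi * t)) ^ 2 ≠ 0 := pow_ne_zero _ (Real.exp_pos _).ne'
    apply mul_left_cancel₀ h3
    linear_combination h2)
  obtain ⟨e1, -, e2⟩ := this
  linarith

end Expansion

section LatticeExpansion

open Filter Topology Matrix

variable {ι : Type*} [Fintype ι] {A : Matrix ι ι ℤ}

theorem int_form_nonneg (hA : (A.map (Int.cast : ℤ → ℝ)).PosDef) (m : ι → ℤ) :
    0 ≤ m ⬝ᵥ A *ᵥ m := by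
  have := realForm_nonneg hA fun i => (m i : ℝ)
  rw [realForm_intCast] at this
  exact_mod_cast this

theorem int_form_pos (hA : (A.map (Int.cast : ℤ → ℝ)).PosDef) {m : ι → ℤ} (hm : m ≠ 0) :
    0 < m ⬝ᵥ A *ᵥ m := by
  have : 0 < A.realForm fun i => (m i : ℝ) := by
    have h : (fun i => (m i : ℝ)) ≠ 0 := fun h => hm (funext fun i => by
      simpa using congrFun h i)
    simpa [realForm] using hA.dotProduct_mulVec_pos h
  rw [realForm_intCast] at this
  exact_mod_cast this

variable [DecidableEq ι]

/-- Expansions of the theta series of a unimodular lattice. -/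
theorem hasThetaJet_latticeTheta (hA : (A.map (Int.cast : ℤ → ℝ)).PosDef) (hsymm : A.IsSymm)
    (hdet : A.det = 1) {k : ℕ} (hk : Fintype.card ι = 2 * k) (hk4 : k % 4 = 1) {c : ι → ℤ}
    (hc : IsCharacteristic A c) :
    HasThetaJet (latticeTheta A 0) (fun τ => latticeTheta A 0 (τ + 1))
      (latticeTheta A fun i => (c i : ℝ) / 2)
      (Nat.card {m : ι → ℤ // m ⬝ᵥ A *ᵥ m = 1}) (Nat.card {m : ι → ℤ // m ⬝ᵥ A *ᵥ m = 2})
      (Nat.card {m : ι → ℤ // (c + 2 • m) ⬝ᵥ A *ᵥ (c + 2 • m) = 2})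
      (Nat.card {m : ι → ℤ // (c + 2 • m) ⬝ᵥ A *ᵥ (c + 2 • m) = 10}) := by
  have hN (m : ι → ℤ) : ∃ n : ℕ, m ⬝ᵥ A *ᵥ m = n := Int.eq_ofNat_of_zero_le (int_form_nonneg hA m)
  choose N hN using hN
  have hM (m : ι → ℤ) : ∃ n : ℕ, (c + 2 • m) ⬝ᵥ A *ᵥ (c + 2 • m) = 2 + 8 * n := by
    obtain ⟨a, ha⟩ := (hc.norm_modEq hA hsymm hdet hk).dvd
    obtain ⟨b, hb⟩ := hc.norm_add_two_smul hsymm m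
    have h0 := int_form_nonneg hA (c + 2 • m)
    refine ⟨(((c + 2 • m) ⬝ᵥ A *ᵥ (c + 2 • m) - 2) / 8).toNat, ?_⟩
    omega
  choose M hM using hM
  have hexp (n : ℕ) (t : ℝ) : Real.exp (-(Real.pi * t)) ^ n = Real.exp (-(Real.pi * t * n)) := by
    rw [← Real.exp_nat_mul]
    congr 1
    ring
  have hNs : Summable fun m => Real.exp (-Real.pi) ^ N m := by
    refine (summable_exp_neg_realForm hA hdet Real.pi_pos 0).congr fun m => ?_
    rw [zero_add, realForm_intCast, hN]
    simpa using (hexp (N m) 1).symm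
  have hMs : Summable fun m => Real.exp (-Real.pi) ^ (2 * M m) := by
    refine ((summable_exp_neg_realForm hA hdet Real.pi_pos fun i => (c i : ℝ) / 2).mul_left
      (Real.exp (Real.pi / 2))).congr fun m => ?_
    have h1 := hexp (2 * M m) 1
    rw [mul_one] at h1
    rw [realForm_half_add A c, hM, h1, ← Real.exp_add]
    congr 1
    push_cast
    ring
  refine ⟨fun x => ∑' m, x ^ N m, fun x => ∑' m, x ^ (2 * M m),
    (hasJet_tsum_pow (Real.exp_pos _) hNs).congr_coeff ?_ ?_ ?_,
    (hasJet_tsum_pow (Real.exp_pos _) hMs).congr_coeff ?_ ?_ ?_, fun t ht => ⟨?_, ?_, ?_⟩⟩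
  · rw [Nat.cast_eq_one, Nat.card_eq_one_iff_exists]
    refine ⟨⟨0, by simpa using (hN 0).symm⟩, fun ⟨m, hm⟩ => Subtype.ext ?_⟩
    by_contra h
    have := int_form_pos hA h
    rw [hN, hm] at this
    simp at this
  · congr 1
    refine Nat.card_congr (Equiv.subtypeEquivRight fun m => ?_)
    rw [hN]
    norm_cast
  · congr 1
    refine Nat.card_congr (Equiv.subtypeEquivRight fun m => ?_)
    rw [hN]
    norm_cast
  · congr 1
    refine Nat.card_congr (Equiv.subtypeEquivRight fun m => ?_)
    rw [hM]
    omega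
  · rw [Nat.cast_eq_zero, Nat.card_eq_zero]
    exact Or.inl ⟨fun ⟨m, hm⟩ => by omega⟩
  · congr 1
    refine Nat.card_congr (Equiv.subtypeEquivRight fun m => ?_)
    rw [hM]
    omega
  · rw [latticeTheta, Complex.ofReal_tsum]
    refine tsum_congr fun m => ?_
    rw [zero_add, realForm_intCast, hN, hexp]
    push_cast
    congr 1
    linear_combination (Real.pi * t * N m : ℂ) * Complex.I_mul_I
  · refine (latticeTheta_zero_add_one _).trans ?_
    rw [Complex.ofReal_tsum]
    refine tsum_congr fun m => ?_
    rw [realForm_intCast, hN, neg_pow, hexp, mul_comm]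
    have h1 : Complex.exp (Real.pi * Complex.I * ((N m : ℤ) : ℂ)) = (-1) ^ N m := by
      rw [← Complex.exp_pi_mul_I, ← Complex.exp_nat_mul]
      congr 1
      push_cast
      ring
    rw [h1]
    push_cast
    congr 2
    linear_combination (Real.pi * t * N m : ℂ) * Complex.I_mul_I
  · rw [latticeTheta, ← tsum_mul_left, Complex.ofReal_tsum]
    refine tsum_congr fun m => ?_
    rw [realForm_half_add, hM, hexp, ← Real.exp_add]
    push_cast
    congr 1
    linear_combination (Real.pi * t * (2 + 8 * M m) / 4 : ℂ) * Complex.I_mul_I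

theorem tendsto_latticeTheta_half (hA : (A.map (Int.cast : ℤ → ℝ)).PosDef)
    (hdet : A.det = 1) {c : ι → ℤ} (hc : ∀ m : ι → ℤ, c + 2 • m ≠ 0) :
    Tendsto (latticeTheta A fun i => (c i : ℝ) / 2) (comap Complex.im atTop) (𝓝 0) := by
  set C := ∑' m : ι → ℤ, Real.exp (-(Real.pi *
    A.realForm ((fun i => (c i : ℝ) / 2) + fun i => (m i : ℝ)))) with hC
  have hlim : Tendsto (fun y : ℝ => Real.exp (-(Real.pi * (y - 1) / 4)) * C) atTop (𝓝 0) := by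
    rw [← zero_mul C]
    refine Tendsto.mul_const C (Real.tendsto_exp_neg_atTop_nhds_zero.comp ?_)
    exact ((tendsto_atTop_add_const_right _ (-1) tendsto_id).const_mul_atTop
      Real.pi_pos).atTop_div_const (by norm_num)
  refine squeeze_zero_norm' ?_ (hlim.comp tendsto_comap)
  filter_upwards [tendsto_comap.eventually (eventually_ge_atTop (1 : ℝ))] with τ hτ
  refine (norm_latticeTheta_le hA hdet _ (by linarith)).trans ?_
  rw [Function.comp_apply, hC, ← tsum_mul_left]
  refine Summable.tsum_le_tsum (fun m => ?_)
    (summable_exp_neg_realForm hA hdet (mul_pos Real.pi_pos (by linarith)) _)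
    ((summable_exp_neg_realForm hA hdet Real.pi_pos _).mul_left _)
  rw [← Real.exp_add, Real.exp_le_exp]
  have h1 : (1 : ℝ) / 4 ≤ A.realForm ((fun i => (c i : ℝ) / 2) + fun i => (m i : ℝ)) := by
    rw [realForm_half_add]
    have : (1 : ℝ) ≤ ((c + 2 • m) ⬝ᵥ A *ᵥ (c + 2 • m) : ℤ) := by
      exact_mod_cast int_form_pos hA (hc m)
    gcongr
  have h2 := mul_le_mul_of_nonneg_left h1
    (mul_nonneg Real.pi_pos.le (sub_nonneg.2 hτ))
  linarith

end LatticeExpansion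

section SquareLattice

open Filter Topology Matrix

theorem isCharacteristic_one :
    IsCharacteristic (1 : Matrix (Fin 2) (Fin 2) ℤ) fun _ => 1 := by
  intro m
  have key (a : ℤ) : (2 : ℤ) ∣ a - a * a := by
    have := Int.even_mul_pred_self a
    rw [show a - a * a = -(a * (a - 1)) by ring]
    exact (this.two_dvd).neg_right
  simpa [dotProduct, Fin.sum_univ_two, add_sub_add_comm] using dvd_add (key (m 0)) (key (m 1))

theorem card_one_form_eq {p : ℤ → ℤ → Prop} [∀ a b, Decidable (p a b)] {n : ℕ}
    (hp : ∀ a b, p a b → a ∈ Finset.Icc (-3 : ℤ) 3 ∧ b ∈ Finset.Icc (-3 : ℤ) 3)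
    (hn : (((Finset.Icc (-3 : ℤ) 3) ×ˢ (Finset.Icc (-3 : ℤ) 3)).filter
      fun x => p x.1 x.2).card = n) :
    Nat.card {m : Fin 2 → ℤ // p (m 0) (m 1)} = n := by
  rw [Nat.card_congr ((finTwoArrowEquiv ℤ).subtypeEquiv (q := fun x => p x.1 x.2)
    fun m => by simp), ← hn]
  exact Nat.subtype_card _ fun x => by simpa using fun h => by simpa using hp _ _ h

theorem hasThetaJet_one :
    HasThetaJet (latticeTheta (1 : Matrix (Fin 2) (Fin 2) ℤ) 0)
      (fun τ => latticeTheta (1 : Matrix (Fin 2) (Fin 2) ℤ) 0 (τ + 1))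
      (latticeTheta (1 : Matrix (Fin 2) (Fin 2) ℤ) fun i => (((fun _ => 1) i : ℤ) : ℝ) / 2)
      4 4 4 8 := by
  have h := hasThetaJet_latticeTheta (k := 1) (A := (1 : Matrix (Fin 2) (Fin 2) ℤ))
    (by simpa using PosDef.one) (by simp) (by simp) (by simp) (by norm_num) isCharacteristic_one
  have c1 : Nat.card {m : Fin 2 → ℤ // m ⬝ᵥ (1 : Matrix (Fin 2) (Fin 2) ℤ) *ᵥ m = 1} = 4 := by
    simp only [one_mulVec, dotProduct, Fin.sum_univ_two]
    refine card_one_form_eq (p := fun a b => a * a + b * b = 1) (fun a b hab => ?_) (by decide)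
    simp only [Finset.mem_Icc]
    refine ⟨⟨?_, ?_⟩, ?_, ?_⟩ <;> nlinarith
  have c2 : Nat.card {m : Fin 2 → ℤ // m ⬝ᵥ (1 : Matrix (Fin 2) (Fin 2) ℤ) *ᵥ m = 2} = 4 := by
    simp only [one_mulVec, dotProduct, Fin.sum_univ_two]
    refine card_one_form_eq (p := fun a b => a * a + b * b = 2) (fun a b hab => ?_) (by decide)
    simp only [Finset.mem_Icc]
    refine ⟨⟨?_, ?_⟩, ?_, ?_⟩ <;> nlinarith
  have c3 : Nat.card {m : Fin 2 → ℤ // ((fun _ => 1) + 2 • m) ⬝ᵥ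
      (1 : Matrix (Fin 2) (Fin 2) ℤ) *ᵥ ((fun _ => 1) + 2 • m) = 2} = 4 := by
    simp only [one_mulVec, dotProduct, Fin.sum_univ_two, Pi.add_apply, Pi.smul_apply]
    refine card_one_form_eq (p := fun a b => (1 + 2 • a) * (1 + 2 • a) +
      (1 + 2 • b) * (1 + 2 • b) = 2) (fun a b hab => ?_) (by decide)
    simp only [Finset.mem_Icc, nsmul_eq_mul, Nat.cast_ofNat] at hab ⊢
    refine ⟨⟨?_, ?_⟩, ?_, ?_⟩ <;> nlinarith
  have c4 : Nat.card {m : Fin 2 → ℤ // ((fun _ => 1) + 2 • m) ⬝ᵥ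
      (1 : Matrix (Fin 2) (Fin 2) ℤ) *ᵥ ((fun _ => 1) + 2 • m) = 10} = 8 := by
    simp only [one_mulVec, dotProduct, Fin.sum_univ_two, Pi.add_apply, Pi.smul_apply]
    refine card_one_form_eq (p := fun a b => (1 + 2 • a) * (1 + 2 • a) +
      (1 + 2 • b) * (1 + 2 • b) = 10) (fun a b hab => ?_) (by decide)
    simp only [Finset.mem_Icc, nsmul_eq_mul, Nat.cast_ofNat] at hab ⊢
    refine ⟨⟨?_, ?_⟩, ?_, ?_⟩ <;> nlinarith
  rw [c1, c2, c3, c4] at h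
  exact_mod_cast h

end SquareLattice

section CharacteristicVector

open Filter Topology Matrix

variable {ι : Type*} [Fintype ι] {A : Matrix ι ι ℤ}

theorem card_norm_two_le (hA : (A.map (Int.cast : ℤ → ℝ)).PosDef)
    (h1 : ∀ m : ι → ℤ, m ⬝ᵥ A *ᵥ m ≠ 1) (c : ι → ℤ) :
    Nat.card {m : ι → ℤ // (c + 2 • m) ⬝ᵥ A *ᵥ (c + 2 • m) = 2} ≤ 2 := by
  by_cases hne : ∃ m₀ : ι → ℤ, (c + 2 • m₀) ⬝ᵥ A *ᵥ (c + 2 • m₀) = 2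
  swap
  · have : IsEmpty {m : ι → ℤ // (c + 2 • m) ⬝ᵥ A *ᵥ (c + 2 • m) = 2} :=
      ⟨fun x => hne ⟨x.1, x.2⟩⟩
    rw [Nat.card_of_isEmpty]
    exact Nat.zero_le _
  obtain ⟨m₀, hm₀⟩ := hne
  have hsub : {m : ι → ℤ | (c + 2 • m) ⬝ᵥ A *ᵥ (c + 2 • m) = 2} ⊆ {m₀, -c - m₀} := by
    intro m hm
    have hm : (c + 2 • m) ⬝ᵥ A *ᵥ (c + 2 • m) = 2 := hm
    have par : 2 * ((m - m₀) ⬝ᵥ A *ᵥ (m - m₀) + (m + m₀ + c) ⬝ᵥ A *ᵥ (m + m₀ + c)) =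
        (c + 2 • m) ⬝ᵥ A *ᵥ (c + 2 • m) + (c + 2 • m₀) ⬝ᵥ A *ᵥ (c + 2 • m₀) := by
      simp only [two_nsmul, mulVec_add, mulVec_sub, dotProduct_add, dotProduct_sub,
        add_dotProduct, sub_dotProduct]
      ring
    have ha := int_form_nonneg hA (m - m₀)
    have hb := int_form_nonneg hA (m + m₀ + c)
    have ha1 := h1 (m - m₀)
    have hb1 := h1 (m + m₀ + c)
    have : (m - m₀) ⬝ᵥ A *ᵥ (m - m₀) = 0 ∨ (m + m₀ + c) ⬝ᵥ A *ᵥ (m + m₀ + c) = 0 := by omega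
    rcases this with h | h
    · left
      by_contra hne
      exact (int_form_pos hA (sub_ne_zero.2 hne)).ne' h
    · right
      by_contra hne
      refine (int_form_pos hA (m := m + m₀ + c) fun h0 => hne ?_).ne' h
      rw [Set.mem_singleton_iff]
      linear_combination h0
  exact (Set.ncard_le_ncard hsub (Set.toFinite _)).trans ((Set.ncard_insert_le _ _).trans (by simp))

theorem IsCharacteristic.exists_norm_ten [DecidableEq ι] (hcard : Fintype.card ι = 26)
    (hA : (A.map (Int.cast : ℤ → ℝ)).PosDef) (hsymm : A.IsSymm) (hdet : A.det = 1)
    (h1 : ∀ m : ι → ℤ, m ⬝ᵥ A *ᵥ m ≠ 1) {c : ι → ℤ} (hc : IsCharacteristic A c) :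
    ∃ m : ι → ℤ, (c + 2 • m) ⬝ᵥ A *ᵥ (c + 2 • m) = 10 := by
  have hodd (m : Fin 2 → ℤ) : (fun _ : Fin 2 => (1 : ℤ)) + 2 • m ≠ 0 := fun h => by
    have := congrFun h 0
    simp only [two_nsmul, Pi.add_apply, Pi.zero_apply] at this
    omega
  have hrel := (isThetaTriple_latticeTheta (k := 13) hA hdet hcard hc).jet_relation
    (isThetaTriple_latticeTheta (k := 1) (A := (1 : Matrix (Fin 2) (Fin 2) ℤ))
      (by simpa using PosDef.one) (by simp) (by simp) isCharacteristic_one)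
    (tendsto_latticeTheta_half (by simpa using PosDef.one) (by simp) hodd)
    (hasThetaJet_latticeTheta (k := 13) hA hsymm hdet hcard (by norm_num) hc) hasThetaJet_one
  have : IsEmpty {m : ι → ℤ // m ⬝ᵥ A *ᵥ m = 1} := ⟨fun x => h1 _ x.2⟩
  rw [Nat.card_of_isEmpty (α := {m : ι → ℤ // m ⬝ᵥ A *ᵥ m = 1})] at hrel
  by_contra! hne
  have : IsEmpty {m : ι → ℤ // (c + 2 • m) ⬝ᵥ A *ᵥ (c + 2 • m) = 10} := ⟨fun x => hne _ x.2⟩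
  rw [Nat.card_of_isEmpty (α := {m : ι → ℤ // (c + 2 • m) ⬝ᵥ A *ᵥ (c + 2 • m) = 10})] at hrel
  have hle : (Nat.card {m : ι → ℤ // (c + 2 • m) ⬝ᵥ A *ᵥ (c + 2 • m) = 2} : ℝ) ≤ 2 := by
    exact_mod_cast card_norm_two_le hA h1 c
  have hn : (0 : ℝ) ≤ Nat.card {m : ι → ℤ // m ⬝ᵥ A *ᵥ m = 2} := Nat.cast_nonneg _
  push_cast at hrel
  linarith

end CharacteristicVector

section GramMatrixReduction

open Matrix

variable {ι : Type*}

theorem posSemidef_map_intCast [Fintype ι] {A : Matrix ι ι ℤ} (hsymm : A.IsSymm)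
    (h : ∀ m : ι → ℤ, 0 ≤ m ⬝ᵥ A *ᵥ m) :
    (A.map (Int.cast : ℤ → ℝ)).PosSemidef := by
  refine .of_dotProduct_mulVec_nonneg ?_ fun v => ?_
  · rw [IsHermitian, conjTranspose_eq_transpose_of_trivial, ← transpose_map, hsymm.eq]
  have hrat (q : ι → ℚ) : 0 ≤ (fun i => (q i : ℝ)) ⬝ᵥ
      A.map (Int.cast : ℤ → ℝ) *ᵥ fun i => (q i : ℝ) := by
    obtain ⟨d, hd⟩ := IsLocalization.exist_integer_multiples_of_finite (nonZeroDivisors ℤ) q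
    choose m hm using hd
    have hd0 : (0 : ℝ) < ((d : ℤ) : ℝ) ^ 2 := by
      have : ((d : ℤ) : ℝ) ≠ 0 := by exact_mod_cast nonZeroDivisors.coe_ne_zero d
      positivity
    have hcast : (fun i => (m i : ℝ)) = ((d : ℤ) : ℝ) • fun i => (q i : ℝ) := by
      ext i
      have := hm i
      simp only [eq_intCast, zsmul_eq_mul] at this
      simp only [Pi.smul_apply, smul_eq_mul]
      exact_mod_cast this
    have hm0 : (0 : ℝ) ≤ ((m ⬝ᵥ A *ᵥ m : ℤ) : ℝ) := by exact_mod_cast h m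
    rw [← realForm_intCast, Matrix.realForm, hcast, mulVec_smul, smul_dotProduct,
      dotProduct_smul, smul_eq_mul, smul_eq_mul, ← mul_assoc, ← sq] at hm0
    exact nonneg_of_mul_nonneg_right hm0 hd0
  have hdense : DenseRange fun (q : ι → ℚ) (i : ι) => (q i : ℝ) :=
    DenseRange.piMap fun _ => Rat.denseRange_cast
  refine hdense.induction_on (p := fun v : ι → ℝ => 0 ≤ star v ⬝ᵥ A.map Int.cast *ᵥ v) v
    (isClosed_le continuous_const ?_) fun q => by simpa using hrat q
  simp only [star_trivial]
  fun_prop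

variable {L : Type*} [AddCommGroup L]

theorem isUnit_det_toMatrix₂ [Fintype ι] [DecidableEq ι] (b : Module.Basis ι ℤ L)
    {B : L →ₗ[ℤ] L →ₗ[ℤ] ℤ}
    (hB : Function.Surjective fun x : L => B x) :
    IsUnit (LinearMap.toMatrix₂ b b B).det := by
  rw [← isUnit_iff_isUnit_det, ← vecMul_surjective_iff_isUnit]
  intro v
  obtain ⟨x, hx⟩ := hB (b.constr ℤ v)
  refine ⟨b.equivFun x, funext fun j => ?_⟩
  have hj : B x (b j) = v j :=
    (LinearMap.congr_fun hx (b j)).trans (b.constr_basis ℤ _ j)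
  rw [← hj]
  conv_rhs => rw [← b.sum_equivFun x]
  simp [vecMul, dotProduct, LinearMap.toMatrix₂_apply, -Module.Basis.sum_repr]

theorem exists_apply_self_modEq (b : Module.Basis ι ℤ L) {B : L →ₗ[ℤ] L →ₗ[ℤ] ℤ}
    (hsymm : ∀ x y : L, B x y = B y x) (hB : Function.Surjective fun x : L => B x) :
    ∃ c : L, ∀ x : L, (2 : ℤ) ∣ B c x - B x x := by
  obtain ⟨c, hc⟩ := hB (b.constr ℤ fun i => B (b i) (b i))
  refine ⟨c, fun x => ?_⟩
  have hcb (i : ι) : B c (b i) = B (b i) (b i) :=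
    (LinearMap.congr_fun hc (b i)).trans (b.constr_basis ℤ _ i)
  induction b.mem_span x using Submodule.span_induction with
  | mem x hx =>
    obtain ⟨i, rfl⟩ := hx
    simp [hcb]
  | zero => simp
  | add x y _ _ hx hy =>
    have : B c (x + y) - B (x + y) (x + y) =
        (B c x - B x x) + (B c y - B y y) - 2 * B x y := by
      simp only [map_add, LinearMap.add_apply, hsymm y x]
      ring
    rw [this]
    exact dvd_sub (dvd_add hx hy) (dvd_mul_right _ _)
  | smul a x _ hx =>
    have : B c (a • x) - B (a • x) (a • x) = a * (B c x - B x x) - a * (a - 1) * B x x := by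
      simp only [map_smul, LinearMap.smul_apply, smul_eq_mul]
      ring
    rw [this]
    exact dvd_sub (dvd_mul_of_dvd_right hx _)
      (dvd_mul_of_dvd_left (Int.even_mul_pred_self a).two_dvd _)

end GramMatrixReduction

/-- Every 26-dimensional positive definite unimodular lattice with no vectors of norm 1 has
a characteristic vector of norm 10. -/
theorem unimodular26_characteristic_vector_norm_ten
    (L : Type*) [AddCommGroup L] [Module.Free ℤ L] [Module.Finite ℤ L]
    (hrank : Module.finrank ℤ L = 26)
    (B : L →ₗ[ℤ] L →ₗ[ℤ] ℤ)
    (hsymm : ∀ x y : L, B x y = B y x)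
    (hpos : ∀ x : L, x ≠ 0 → 0 < B x x)
    (hunimod : Function.Bijective fun x : L => B x)
    (hno1 : ∀ x : L, B x x ≠ 1) :
    ∃ c : L, B c c = 10 ∧ ∀ x : L, (2 : ℤ) ∣ (B c x - B x x) := by
  let b := Module.finBasisOfFinrankEq ℤ L hrank
  set A := LinearMap.toMatrix₂ b b B with hA
  have hAB (x y : Fin 26 → ℤ) :
      dotProduct x (A.mulVec y) = B (b.equivFun.symm x) (b.equivFun.symm y) :=
    dotProduct_toMatrix₂_mulVec b b B x y
  have hAsymm : A.IsSymm := by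
    ext i j
    simp [hA, LinearMap.toMatrix₂_apply, hsymm]
  have hpsd := posSemidef_map_intCast hAsymm fun m => by
    rw [hAB]
    by_cases h : b.equivFun.symm m = 0
    · simp [h]
    · exact (hpos _ h).le
  have hunit : IsUnit A.det := isUnit_det_toMatrix₂ b hunimod.2
  have hdetmap : (A.map (Int.cast : ℤ → ℝ)).det = (A.det : ℝ) :=
    ((Int.castRingHom ℝ).map_det A).symm
  have hpd : (A.map (Int.cast : ℤ → ℝ)).PosDef := by
    rw [hpsd.posDef_iff_det_ne_zero, hdetmap]
    exact_mod_cast hunit.ne_zero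
  have hdet : A.det = 1 := by
    have : 0 < A.det := by exact_mod_cast hdetmap ▸ hpd.det_pos
    rcases Int.isUnit_iff.1 hunit with h | h <;> omega
  obtain ⟨c, hc⟩ := exists_apply_self_modEq b hsymm hunimod.2
  have hchar : IsCharacteristic A (b.equivFun c) := fun m => by
    rw [hAB, hAB, LinearEquiv.symm_apply_apply]
    exact hc _
  obtain ⟨m, hm⟩ := hchar.exists_norm_ten (by simp) hpd hAsymm hdet
    fun m => by rw [hAB]; exact hno1 _
  refine ⟨b.equivFun.symm (b.equivFun c + 2 • m), by rw [← hAB, hm], fun x => ?_⟩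
  have : B (b.equivFun.symm (b.equivFun c + 2 • m)) x - B x x =
      (B c x - B x x) + 2 * B (b.equivFun.symm m) x := by
    simp only [two_nsmul, map_add, LinearEquiv.symm_apply_apply, LinearMap.add_apply]
    ring
  rw [this]
  exact dvd_add (hc x) (dvd_mul_right _ _)
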